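/- arXiv:1707.05440 — 3 statements merged into one kernel-verified Lean document; each statement's English description precedes it below -/
import Mathlib

section
/- Every set S of n points in the plane in general position admits at least ⌊√(n/12)⌋ pairwise edge-disjoint plane spanning trees. -/
/-- Points in the plane. -/
abbrev Pt : Type := ℝ × ℝ

/-- A finite point set is in general position if no three of its points are collinear. -/
def GenPos (S : Finset Pt) : Prop :=
  ∀ p ∈ S, ∀ q ∈ S, ∀ r ∈ S, p ≠ q → p ≠ r → q ≠ r →
    ¬ Collinear ℝ ({p, q, r} : Set Pt)

/-- A geometric graph on `S` (a simple graph on the points of `S`, edges drawn as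
straight segments) is plane if the open segments of any two distinct edges are disjoint. -/
def IsPlaneGraph {S : Finset Pt} (G : SimpleGraph {x // x ∈ S}) : Prop :=
  ∀ a b c d : {x // x ∈ S}, G.Adj a b → G.Adj c d → s(a, b) ≠ s(c, d) →
    openSegment ℝ (a : Pt) (b : Pt) ∩ openSegment ℝ (c : Pt) (d : Pt) = ∅

/-- A plane spanning tree of `S`: a tree on all points of `S` drawn without crossings. -/
def IsPlaneSpanningTree {S : Finset Pt} (G : SimpleGraph {x // x ∈ S}) : Prop :=
  G.IsTree ∧ IsPlaneGraph G

/-- A plane spanning path of `S`: a plane spanning tree in which every vertex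
has degree at most two (i.e. a plane Hamiltonian path). -/
def IsPlaneSpanningPath {S : Finset Pt} (G : SimpleGraph {x // x ∈ S}) : Prop :=
  IsPlaneSpanningTree G ∧
    ∀ v a b c : {x // x ∈ S}, G.Adj v a → G.Adj v b → G.Adj v c →
      (a = b ∨ a = c ∨ b = c)

/-- The open segment spanned by an unordered pair of points. -/
def segOpen (e : Sym2 Pt) : Set Pt :=
  Sym2.lift ⟨fun a b => openSegment ℝ a b, fun a b => openSegment_symm ℝ a b⟩ e

/-- `F` is a crossing family in `S`: a set of nondegenerate segments with endpoints
in `S`, any two of which cross (their open segments intersect). -/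
def IsCrossingFamily (S : Finset Pt) (F : Finset (Sym2 Pt)) : Prop :=
  (∀ e ∈ F, ¬ e.IsDiag ∧ ∀ x ∈ e, x ∈ S) ∧
  (∀ e ∈ F, ∀ f ∈ F, e ≠ f → (segOpen e ∩ segOpen f).Nonempty)

/-- `x` lies strictly to the left of the directed line from `p` to `q`. -/
def leftOf (p q x : Pt) : Prop :=
  0 < (q.1 - p.1) * (x.2 - p.2) - (q.2 - p.2) * (x.1 - p.1)

/-- `x` lies strictly to the right of the directed line from `p` to `q`. -/
def rightOf (p q x : Pt) : Prop :=
  (q.1 - p.1) * (x.2 - p.2) - (q.2 - p.2) * (x.1 - p.1) < 0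

/-- The double star on `S` associated with the directed edge `pq`: the edge `pq`,
the edges from `p` to all points strictly left of the directed line `pq`, and the
edges from `q` to all points strictly right of it. -/
def doubleStar (S : Finset Pt) (p q : Pt) : SimpleGraph {x // x ∈ S} :=
  SimpleGraph.fromRel fun a b =>
    ((a : Pt) = p ∧ (b : Pt) = q) ∨
    ((a : Pt) = p ∧ leftOf p q (b : Pt)) ∨
    ((a : Pt) = q ∧ rightOf p q (b : Pt))

/-- The regular wheel configuration `W_{2n}`: `2n-1` points regularly spaced on the
unit circle together with its center. -/
noncomputable def wheel (n : ℕ) : Finset Pt :=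
  insert ((0 : ℝ), (0 : ℝ)) <| (Finset.range (2 * n - 1)).image fun j : ℕ =>
    (Real.cos (2 * Real.pi * (j : ℝ) / ((2 * n - 1 : ℕ) : ℝ)),
     Real.sin (2 * Real.pi * (j : ℝ) / ((2 * n - 1 : ℕ) : ℝ)))

/-- Signed (doubled) area of the triangle `c p q`. -/
def crArea (c p q : Pt) : ℝ :=
  (p.1 - c.1) * (q.2 - c.2) - (p.2 - c.2) * (q.1 - c.1)

lemma crArea_mem_line {p q r : Pt} (hpq : p ≠ q) (h : crArea r p q = 0) :
    r ∈ line[ℝ, p, q] := by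
  obtain ⟨p1, p2⟩ := p
  obtain ⟨q1, q2⟩ := q
  obtain ⟨r1, r2⟩ := r
  simp only [crArea] at h
  by_cases h1 : q1 = p1
  · have h2 : q2 - p2 ≠ 0 := by
      intro h2
      apply hpq
      rw [h1, sub_eq_zero.mp h2]
    subst h1
    have h3 : r1 = q1 := by
      have : (q1 - r1) * (q2 - p2) = 0 := by linarith
      rcases mul_eq_zero.mp this with h | h
      · linarith
      · exact absurd h h2
    have := AffineMap.lineMap_mem_affineSpan_pair ((r2 - p2) / (q2 - p2)) (q1, p2) (q1, q2)
    convert this using 1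
    simp only [AffineMap.lineMap_apply, vsub_eq_sub, vadd_eq_add, Prod.mk_sub_mk, Prod.smul_mk,
      Prod.mk_add_mk, smul_eq_mul, Prod.mk.injEq]
    refine ⟨by rw [h3]; ring, by field_simp; ring⟩
  · have h2 : q1 - p1 ≠ 0 := sub_ne_zero.mpr h1
    have := AffineMap.lineMap_mem_affineSpan_pair ((r1 - p1) / (q1 - p1)) (p1, p2) (q1, q2)
    convert this using 1
    simp only [AffineMap.lineMap_apply, vsub_eq_sub, vadd_eq_add, Prod.mk_sub_mk, Prod.smul_mk,
      Prod.mk_add_mk, smul_eq_mul, Prod.mk.injEq]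
    refine ⟨by field_simp; ring, ?_⟩
    field_simp
    linarith

lemma GenPos.crArea_ne {S : Finset Pt} (h : GenPos S) {p q r : Pt} (hp : p ∈ S) (hq : q ∈ S)
    (hr : r ∈ S) (hpq : p ≠ q) (hpr : p ≠ r) (hqr : q ≠ r) : crArea p q r ≠ 0 := by
  intro h0
  refine h p hp q hq r hr hpq hpr hqr ?_
  exact collinear_insert_of_mem_affineSpan_pair (crArea_mem_line hqr h0)

/-- Genericity of the centre. -/
def IsGeneric (S : Finset Pt) (c : Pt) : Prop :=
  c ∉ S ∧ ∀ p ∈ S, ∀ q ∈ S, p ≠ q → crArea c p q ≠ 0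

lemma exists_generic (S : Finset Pt) (O : Set Pt) (hO : IsOpen O) (hne : O.Nonempty) :
    ∃ c ∈ O, IsGeneric S c := by
  classical
  by_contra hcon
  push Not at hcon
  obtain ⟨E, hE, hEc⟩ : ∃ E : Set (Pt × Pt),
      (∀ p ∈ S, ∀ q ∈ S, (p, q) ∈ E) ∧ E.Countable :=
    ⟨((S ×ˢ S : Finset (Pt × Pt)) : Set (Pt × Pt)), fun p hp q hq => by simp [hp, hq],
      Finset.countable_toSet _⟩
  have hsub : O ⊆ (S : Set Pt) ∪ ⋃ e ∈ E,
      (line[ℝ, e.1, e.2] : Set Pt) := by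
    intro c hc
    have := hcon c hc
    unfold IsGeneric at this
    push Not at this
    by_cases hcS : c ∈ S
    · left; exact hcS
    · right
      obtain ⟨p, hp, q, hq, hpq, h0⟩ := this hcS
      simp only [Set.mem_iUnion]
      exact ⟨(p, q), hE p hp q hq, crArea_mem_line hpq h0⟩
  have hnull : MeasureTheory.volume ((S : Set Pt) ∪
      ⋃ e ∈ E, (line[ℝ, e.1, e.2] : Set Pt)) = 0 := by
    refine MeasureTheory.measure_union_null (S.finite_toSet.measure_zero _) ?_
    rw [MeasureTheory.measure_biUnion_null_iff hEc]
    intro e _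
    refine MeasureTheory.Measure.addHaar_affineSubspace _ _ ?_
    intro htop
    have h1 := collinear_pair ℝ e.1 e.2
    rw [collinear_iff_finrank_le_one, ← direction_affineSpan, htop, AffineSubspace.direction_top,
      finrank_top] at h1
    simp at h1
  have := hO.measure_pos MeasureTheory.volume hne
  have h2 := MeasureTheory.measure_mono_null hsub hnull
  rw [h2] at this
  exact lt_irrefl _ this

lemma exists_center (S : Finset Pt) (hgp : GenPos S) (hn : 12 ≤ S.card) :
    ∃ c, IsGeneric S c ∧ ∀ U ⊆ S, 4 * U.card ≤ S.card →
      c ∈ convexHull ℝ ((S \ U : Finset Pt) : Set Pt) := by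
  classical
  set s : Finset (Finset Pt) := S.powerset.filter (fun U => 4 * U.card ≤ S.card) with hs
  let F : Finset Pt → Set Pt := fun U => interior (convexHull ℝ ((S \ U : Finset Pt) : Set Pt))
  have hH : (⋂ U ∈ s, F U).Nonempty := by
    refine Convex.helly_theorem' (𝕜 := ℝ) (fun U _ => (convex_convexHull ℝ _).interior) ?_
    intro I hI hcard
    have hc3 : I.card ≤ 3 := by simpa using hcard
    have hb : (I.biUnion id).card ≤ I.card * (S.card / 4) := by
      refine Finset.card_biUnion_le_card_mul _ _ _ ?_
      intro U hU
      have := (Finset.mem_filter.mp (hI hU)).2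
      simp only [id]
      omega
    have hb2 : (I.biUnion id).card ≤ 3 * (S.card / 4) :=
      hb.trans (Nat.mul_le_mul_right _ hc3)
    have hd := Finset.le_card_sdiff (I.biUnion id) S
    have h3 : 2 < (S \ I.biUnion id).card := by omega
    obtain ⟨a, b, c, ha, hb', hc, hab, hac, hbc⟩ := Finset.two_lt_card_iff.mp h3
    have hnc := hgp a (Finset.mem_sdiff.mp ha).1 b (Finset.mem_sdiff.mp hb').1 c
      (Finset.mem_sdiff.mp hc).1 hab hac hbc
    have hint : (interior (convexHull ℝ ({a, b, c} : Set Pt))).Nonempty := by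
      rw [interior_convexHull_nonempty_iff_affineSpan_eq_top]
      have hai := affineIndependent_iff_not_collinear_set.mpr hnc
      have := hai.affineSpan_eq_top_iff_card_eq_finrank_add_one.mpr (by simp)
      rw [← this]
      congr 1
      ext x
      simp [eq_comm]
      tauto
    obtain ⟨x, hx⟩ := hint
    refine ⟨x, ?_⟩
    simp only [Set.mem_iInter]
    intro U hU
    refine interior_mono (convexHull_mono ?_) hx
    have key : ∀ y ∈ S \ I.biUnion id, y ∈ S \ U := by
      intro y hy
      simp only [Finset.mem_sdiff, Finset.mem_biUnion, not_exists, not_and, id] at hy ⊢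
      exact ⟨hy.1, hy.2 U hU⟩
    intro y hy
    simp only [Set.mem_insert_iff, Set.mem_singleton_iff] at hy
    rcases hy with rfl | rfl | rfl
    · exact key _ ha
    · exact key _ hb'
    · exact key _ hc
  have hopen : IsOpen (⋂ U ∈ s, F U) :=
    isOpen_biInter_finset (fun U _ => isOpen_interior)
  obtain ⟨c, hc, hg⟩ := exists_generic S _ hopen hH
  refine ⟨c, hg, fun U hU h4 => ?_⟩
  simp only [Set.mem_iInter] at hc
  exact interior_subset (hc U (by simp [hs, hU, h4]))

lemma exists_triangle {S R : Finset Pt} {c : Pt} (hR : R ⊆ S) (hgp : GenPos S)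
    (hg : IsGeneric S c) (hc : c ∈ convexHull ℝ (R : Set Pt)) :
    ∃ t : Fin 3 → Pt, (∀ a, t a ∈ R) ∧ ∀ a, 0 < crArea c (t a) (t (a + 1)) := by
  obtain ⟨ι, hι, z, w, hz, hai, hw, hw1, hwc⟩ := eq_pos_convex_span_of_mem_convexHull hc
  have hcard : Fintype.card ι ≤ 3 := by
    have := hai.card_le_finrank_succ
    have h2 := Submodule.finrank_le (vectorSpan ℝ (Set.range z))
    have h3 : Module.finrank ℝ Pt = 2 := by simp
    exact this.trans (Nat.succ_le_succ (h2.trans h3.le))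
  have hzR : ∀ i, z i ∈ R := fun i => hz ⟨i, rfl⟩
  have hinj := hai.injective
  generalize hk : Fintype.card ι = k at hcard
  let e : Fin k ≃ ι := (Fintype.equivFinOfCardEq hk).symm
  rw [← e.sum_comp] at hw1 hwc
  have hinj' : ∀ i j, i ≠ j → z (e i) ≠ z (e j) := fun i j h h' => h (e.injective (hinj h'))
  interval_cases k
  · simp at hw1
  · exfalso
    simp at hw1 hwc
    rw [hw1, one_smul] at hwc
    exact hg.1 (hwc ▸ hR (hzR _))
  · exfalso
    simp only [Fin.sum_univ_two] at hw1 hwc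
    refine hg.2 _ (hR (hzR (e 0))) _ (hR (hzR (e 1))) (hinj' 0 1 (by decide)) ?_
    have h1 : w (e 0) = 1 - w (e 1) := by linarith
    rw [← hwc, h1]
    simp only [crArea, Prod.fst_add, Prod.snd_add, Prod.smul_fst, Prod.smul_snd, smul_eq_mul]
    ring
  · simp only [Fin.sum_univ_three] at hw1 hwc
    have h01 := hinj' 0 1 (by decide)
    have h02 := hinj' 0 2 (by decide)
    have h12 := hinj' 1 2 (by decide)
    have hne := hgp.crArea_ne (hR (hzR (e 0))) (hR (hzR (e 1))) (hR (hzR (e 2))) h01 h02 h12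
    have p0 := hw (e 0)
    have p1 := hw (e 1)
    have p2 := hw (e 2)
    have m0 := hzR (e 0)
    have m1 := hzR (e 1)
    have m2 := hzR (e 2)
    generalize z (e 0) = p at *
    generalize z (e 1) = q at *
    generalize z (e 2) = r at *
    generalize w (e 0) = α at *
    generalize w (e 1) = β at *
    generalize w (e 2) = γ at *
    have hα : α = 1 - β - γ := by linarith
    have e1 : crArea c p q = γ * crArea p q r := by
      rw [← hwc, hα]
      simp only [crArea, Prod.fst_add, Prod.snd_add, Prod.smul_fst, Prod.smul_snd, smul_eq_mul]
      ring
    have e2 : crArea c q r = α * crArea p q r := by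
      rw [← hwc, hα]
      simp only [crArea, Prod.fst_add, Prod.snd_add, Prod.smul_fst, Prod.smul_snd, smul_eq_mul]
      ring
    have e3 : crArea c r p = β * crArea p q r := by
      rw [← hwc, hα]
      simp only [crArea, Prod.fst_add, Prod.snd_add, Prod.smul_fst, Prod.smul_snd, smul_eq_mul]
      ring
    have anti : ∀ x y, crArea c y x = - crArea c x y := by
      intro x y; simp only [crArea]; ring
    rcases lt_or_gt_of_ne hne with hneg | hpos
    · refine ⟨![p, r, q], ?_, ?_⟩
      · intro a; fin_cases a <;> simp [m0, m1, m2]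
      · intro a
        fin_cases a
        · change 0 < crArea c p r
          rw [anti r p, e3]; nlinarith
        · change 0 < crArea c r q
          rw [anti q r, e2]; nlinarith
        · change 0 < crArea c q p
          rw [anti p q, e1]; nlinarith
    · refine ⟨![p, q, r], ?_, ?_⟩
      · intro a; fin_cases a <;> simp [m0, m1, m2]
      · intro a
        fin_cases a
        · change 0 < crArea c p q
          rw [e1]; positivity
        · change 0 < crArea c q r
          rw [e2]; positivity
        · change 0 < crArea c r p
          rw [e3]; positivity

lemma exists_triangles {S : Finset Pt} {c : Pt} (hgp : GenPos S) (hg : IsGeneric S c)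
    (hc : ∀ U ⊆ S, 4 * U.card ≤ S.card → c ∈ convexHull ℝ ((S \ U : Finset Pt) : Set Pt))
    (k : ℕ) (hk : 12 * k ≤ S.card) :
    ∃ t : Fin k → Fin 3 → Pt, (∀ i a, t i a ∈ S) ∧
      (∀ i a, 0 < crArea c (t i a) (t i (a + 1))) ∧
      (∀ i j a b, i ≠ j → t i a ≠ t j b) := by
  classical
  induction k with
  | zero => exact ⟨fun i => i.elim0, fun i => i.elim0, fun i => i.elim0, fun i => i.elim0⟩
  | succ k ih =>
    obtain ⟨t, ht1, ht2, ht3⟩ := ih (by omega)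
    set U : Finset Pt := Finset.univ.image (fun e : Fin k × Fin 3 => t e.1 e.2) with hU
    have hUc : U.card ≤ k * 3 := by
      refine Finset.card_image_le.trans ?_
      simp
    have hUS : U ⊆ S := by
      intro x hx
      simp only [hU, Finset.mem_image, Finset.mem_univ, true_and] at hx
      obtain ⟨e, rfl⟩ := hx
      exact ht1 _ _
    obtain ⟨u, hu1, hu2⟩ := exists_triangle (R := S \ U) Finset.sdiff_subset hgp hg
      (hc U hUS (by omega))
    have hun : ∀ a i b, u a ≠ t i b := by
      intro a i b h
      refine (Finset.mem_sdiff.mp (hu1 a)).2 ?_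
      rw [h, hU]
      exact Finset.mem_image.mpr ⟨(i, b), Finset.mem_univ _, rfl⟩
    refine ⟨Fin.cons u t, ?_, ?_, ?_⟩
    · intro i
      refine Fin.cases ?_ ?_ i
      · intro a; exact (Finset.mem_sdiff.mp (hu1 a)).1
      · intro i a; exact ht1 i a
    · intro i
      refine Fin.cases ?_ ?_ i
      · intro a; exact hu2 a
      · intro i a; exact ht2 i a
    · intro i j a b
      refine Fin.cases ?_ ?_ i
      · refine Fin.cases ?_ ?_ j
        · intro h; exact absurd rfl h
        · intro j _; exact hun a j b
      · intro i
        refine Fin.cases ?_ ?_ j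
        · intro _; exact (hun b i a).symm
        · intro j h
          exact ht3 i j a b (fun heq => h (by rw [heq]))

/-- `a` is a vertex of the triangle `t` and `x` lies in the wedge following `a`. -/
def WedgeRel (c : Pt) (t : Fin 3 → Pt) (a x : Pt) : Prop :=
  ∃ i, a = t i ∧ 0 < crArea c (t i) x ∧ crArea c (t (i + 1)) x ≤ 0

lemma crArea_self (c x : Pt) : crArea c x x = 0 := by simp only [crArea]; ring

lemma crArea_anti (c x y : Pt) : crArea c y x = - crArea c x y := by simp only [crArea]; ring

/-- The three-star graph of a triangle around `c`. -/
def wedgeGraph (S : Finset Pt) (c : Pt) (t : Fin 3 → Pt) : SimpleGraph {x // x ∈ S} where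
  Adj x y := WedgeRel c t x y ∨ WedgeRel c t y x
  symm := ⟨fun _ _ h => h.symm⟩
  loopless := ⟨by
    intro x h
    have : WedgeRel c t x x := by tauto
    obtain ⟨i, hi, h1, _⟩ := this
    rw [← hi, crArea_self] at h1
    exact lt_irrefl _ h1⟩

lemma exists_wedge {S : Finset Pt} {c : Pt} (hg : IsGeneric S c) {t : Fin 3 → Pt}
    (hS : ∀ a, t a ∈ S) (ht : ∀ a, 0 < crArea c (t a) (t (a + 1))) {x : Pt} (hx : x ∈ S) :
    ∃ i, WedgeRel c t (t i) x := by
  by_contra hcon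
  have key : ∀ i, 0 < crArea c (t i) x → 0 < crArea c (t (i + 1)) x := by
    intro i h
    by_contra h'
    exact hcon ⟨i, i, rfl, h, not_lt.mp h'⟩
  have k0 : 0 < crArea c (t 0) x → 0 < crArea c (t 1) x := key 0
  have k1 : 0 < crArea c (t 1) x → 0 < crArea c (t 2) x := key 1
  have k2 : 0 < crArea c (t 2) x → 0 < crArea c (t 0) x := key 2
  have h0 : 0 < crArea c (t 0) (t 1) := ht 0
  have h1 : 0 < crArea c (t 1) (t 2) := ht 1
  have h2 : 0 < crArea c (t 2) (t 0) := ht 2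
  have hid : crArea c (t 1) (t 2) * crArea c (t 0) x + crArea c (t 2) (t 0) * crArea c (t 1) x
      + crArea c (t 0) (t 1) * crArea c (t 2) x = 0 := by
    simp only [crArea]; ring
  by_cases hp : 0 < crArea c (t 0) x
  · have a := mul_pos h1 hp
    have b := mul_pos h2 (k0 hp)
    have d := mul_pos h0 (k1 (k0 hp))
    linarith
  · have n0 : crArea c (t 0) x ≤ 0 := not_lt.mp hp
    have n2 : crArea c (t 2) x ≤ 0 := not_lt.mp (fun h => hp (k2 h))
    have n1 : crArea c (t 1) x ≤ 0 := not_lt.mp (fun h => hp (k2 (k1 h)))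
    have a := mul_nonpos_of_nonneg_of_nonpos h1.le n0
    have b := mul_nonpos_of_nonneg_of_nonpos h2.le n1
    have d := mul_nonpos_of_nonneg_of_nonpos h0.le n2
    have z0 : crArea c (t 0) x = 0 := by
      have : crArea c (t 1) (t 2) * crArea c (t 0) x = 0 := by linarith
      exact (mul_eq_zero.mp this).resolve_left h1.ne'
    have z1 : crArea c (t 1) x = 0 := by
      have : crArea c (t 2) (t 0) * crArea c (t 1) x = 0 := by linarith
      exact (mul_eq_zero.mp this).resolve_left h2.ne'
    have e0 : t 0 = x := by
      by_contra h; exact hg.2 _ (hS 0) _ hx h z0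
    have e1 : t 1 = x := by
      by_contra h; exact hg.2 _ (hS 1) _ hx h z1
    rw [e0, e1, crArea_self] at h0
    exact lt_irrefl _ h0

lemma wedgeGraph_connected {S : Finset Pt} {c : Pt} (hg : IsGeneric S c) {t : Fin 3 → Pt}
    (hS : ∀ a, t a ∈ S) (ht : ∀ a, 0 < crArea c (t a) (t (a + 1))) :
    (wedgeGraph S c t).Connected := by
  have hstep : ∀ i, (wedgeGraph S c t).Adj ⟨t i, hS i⟩ ⟨t (i + 1), hS (i + 1)⟩ := by
    intro i
    left
    exact ⟨i, rfl, ht i, (crArea_self _ _).le⟩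
  have r1 : (wedgeGraph S c t).Reachable ⟨t 0, hS 0⟩ ⟨t 1, hS 1⟩ := (hstep 0).reachable
  have r2 : (wedgeGraph S c t).Reachable ⟨t 1, hS 1⟩ ⟨t 2, hS 2⟩ := (hstep 1).reachable
  have r : ∀ i, (wedgeGraph S c t).Reachable ⟨t 0, hS 0⟩ ⟨t i, hS i⟩ := by
    intro i
    fin_cases i
    · exact SimpleGraph.Reachable.refl _
    · exact r1
    · exact r1.trans r2
  rw [SimpleGraph.connected_iff_exists_forall_reachable]
  refine ⟨⟨t 0, hS 0⟩, ?_⟩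
  rintro ⟨x, hx⟩
  obtain ⟨i, hi⟩ := exists_wedge hg hS ht hx
  have : (wedgeGraph S c t).Adj ⟨t i, hS i⟩ ⟨x, hx⟩ := Or.inl hi
  exact (r i).trans this.reachable

lemma wedge_open {c p q x z : Pt} (hpq : 0 < crArea c p q)
    (h1 : 0 < crArea c p x) (h2 : crArea c q x ≤ 0) (hz : z ∈ openSegment ℝ p x) :
    0 < crArea c p z ∧ crArea c q z < 0 := by
  obtain ⟨a, b, ha, hb, hab, rfl⟩ := hz
  have ha' : a = 1 - b := by linarith
  have e1 : crArea c p (a • p + b • x) = b * crArea c p x := by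
    rw [ha']
    simp only [crArea, Prod.fst_add, Prod.snd_add, Prod.smul_fst, Prod.smul_snd, smul_eq_mul]
    ring
  have e2 : crArea c q (a • p + b • x) = b * crArea c q x - a * crArea c p q := by
    rw [ha']
    simp only [crArea, Prod.fst_add, Prod.snd_add, Prod.smul_fst, Prod.smul_snd, smul_eq_mul]
    ring
  rw [e1, e2]
  refine ⟨mul_pos hb h1, ?_⟩
  have := mul_nonpos_of_nonneg_of_nonpos hb.le h2
  have := mul_pos ha hpq
  linarith

lemma star_open {p x y z : Pt} (hx : z ∈ openSegment ℝ p x) (hy : z ∈ openSegment ℝ p y) :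
    crArea p x y = 0 := by
  obtain ⟨a, b, ha, hb, hab, rfl⟩ := hx
  obtain ⟨a', b', ha', hb', hab', h⟩ := hy
  have e1 : a = 1 - b := by linarith
  have e2 : a' = 1 - b' := by linarith
  subst e1 e2
  have h1 := congrArg Prod.fst h
  have h2 := congrArg Prod.snd h
  simp only [Prod.fst_add, Prod.snd_add, Prod.smul_fst, Prod.smul_snd, smul_eq_mul] at h1 h2
  have g1 : b' * (y.1 - p.1) = b * (x.1 - p.1) := by linarith
  have g2 : b' * (y.2 - p.2) = b * (x.2 - p.2) := by linarith
  have : b' * crArea p x y = 0 := by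
    simp only [crArea]
    linear_combination (x.1 - p.1) * g2 - (x.2 - p.2) * g1
  exact (mul_eq_zero.mp this).resolve_left hb'.ne'

lemma wedge_cross {S : Finset Pt} (hgp : GenPos S) {c : Pt} {t : Fin 3 → Pt}
    (ht : ∀ a, 0 < crArea c (t a) (t (a + 1))) {a b d e z : Pt}
    (haS : a ∈ S) (hbS : b ∈ S) (heS : e ∈ S)
    (h1 : WedgeRel c t a b) (h2 : WedgeRel c t d e) (hz1 : z ∈ openSegment ℝ a b)
    (hz2 : z ∈ openSegment ℝ d e) : a = d ∧ b = e := by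
  obtain ⟨i, rfl, hi1, hi2⟩ := h1
  obtain ⟨j, rfl, hj1, hj2⟩ := h2
  have wi := wedge_open (ht i) hi1 hi2 hz1
  have wj := wedge_open (ht j) hj1 hj2 hz2
  have hij : i = j ∨ j = i + 1 ∨ i = j + 1 := by
    clear * -; revert i j; decide
  rcases hij with rfl | rfl | rfl
  · refine ⟨rfl, ?_⟩
    by_contra hbe
    refine hgp.crArea_ne haS hbS heS ?_ ?_ hbe (star_open hz1 hz2)
    · intro h; rw [← h, crArea_self] at hi1; exact lt_irrefl _ hi1
    · intro h; rw [← h, crArea_self] at hj1; exact lt_irrefl _ hj1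
  · linarith [wi.2, wj.1]
  · linarith [wi.1, wj.2]

lemma wedgeGraph_plane {S : Finset Pt} (hgp : GenPos S) {c : Pt} {t : Fin 3 → Pt}
    (ht : ∀ a, 0 < crArea c (t a) (t (a + 1))) : IsPlaneGraph (wedgeGraph S c t) := by
  rintro ⟨a, ha⟩ ⟨b, hb⟩ ⟨d, hd⟩ ⟨e, he⟩ h1 h2 hne
  rw [Set.eq_empty_iff_forall_notMem]
  rintro z ⟨hz1, hz2⟩
  apply hne
  simp only [Sym2.eq_iff, Subtype.mk.injEq]
  simp only at hz1 hz2
  rcases h1 with h1 | h1 <;> rcases h2 with h2 | h2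
  · have := wedge_cross hgp ht ha hb he h1 h2 hz1 hz2
    tauto
  · rw [openSegment_symm] at hz2
    have := wedge_cross hgp ht ha hb hd h1 h2 hz1 hz2
    tauto
  · rw [openSegment_symm] at hz1
    have := wedge_cross hgp ht hb ha he h1 h2 hz1 hz2
    tauto
  · rw [openSegment_symm] at hz1 hz2
    have := wedge_cross hgp ht hb ha hd h1 h2 hz1 hz2
    tauto

lemma wedge_disj {c : Pt} {t u : Fin 3 → Pt} (htu : ∀ a b, t a ≠ u b) {x y : Pt}
    (h1 : WedgeRel c t x y) (h2 : WedgeRel c u x y ∨ WedgeRel c u y x) : False := by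
  obtain ⟨i, rfl, hi, _⟩ := h1
  rcases h2 with ⟨j, hj, _⟩ | ⟨j, rfl, hj, _⟩
  · exact htu i j hj
  · rw [crArea_anti] at hj
    linarith

/-- Every set of `n` points in general position admits at least
`⌊√(n/12)⌋` pairwise edge-disjoint plane spanning trees. -/
theorem sqrt_many_spanning_trees (S : Finset Pt) (n : ℕ) (hS : S.card = n)
    (hgp : GenPos S) :
    ∃ T : Fin ⌊Real.sqrt ((n : ℝ) / 12)⌋₊ → SimpleGraph {x // x ∈ S},
      (∀ i, IsPlaneSpanningTree (T i)) ∧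
      (∀ i j, i ≠ j → Disjoint (T i).edgeSet (T j).edgeSet) := by
  have hk : 12 * ⌊Real.sqrt ((n : ℝ) / 12)⌋₊ ^ 2 ≤ n := by
    have h1 : (⌊Real.sqrt ((n : ℝ) / 12)⌋₊ : ℝ) ≤ Real.sqrt ((n : ℝ) / 12) :=
      Nat.floor_le (Real.sqrt_nonneg _)
    have h2 : (⌊Real.sqrt ((n : ℝ) / 12)⌋₊ : ℝ) ^ 2 ≤ (n : ℝ) / 12 := by
      exact (pow_le_pow_left₀ (by positivity) h1 2).trans_eq
        (Real.sq_sqrt (show (0 : ℝ) ≤ (n : ℝ) / 12 by positivity))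
    have h3 : (12 : ℝ) * (⌊Real.sqrt ((n : ℝ) / 12)⌋₊ : ℝ) ^ 2 ≤ n := by linarith
    exact_mod_cast h3
  generalize ⌊Real.sqrt ((n : ℝ) / 12)⌋₊ = k at hk
  rcases Nat.eq_zero_or_pos k with rfl | hpos
  · exact ⟨fun i => i.elim0, fun i => i.elim0, fun i => i.elim0⟩
  have hkn : 12 * k ≤ S.card := by rw [hS]; nlinarith
  obtain ⟨c, hg, hc⟩ := exists_center S hgp (by omega)
  obtain ⟨t, ht1, ht2, ht3⟩ := exists_triangles hgp hg hc k hkn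
  have hT := fun i => (wedgeGraph_connected hg (ht1 i) (ht2 i)).exists_isTree_le
  choose T hle hT using hT
  refine ⟨T, fun i => ⟨hT i, ?_⟩, ?_⟩
  · intro a b d e h1 h2 hne
    exact wedgeGraph_plane hgp (ht2 i) a b d e (hle i h1) (hle i h2) hne
  · intro i j hij
    rw [Set.disjoint_left]
    intro e
    induction e using Sym2.ind with
    | _ x y =>
      intro h1 h2
      rw [SimpleGraph.mem_edgeSet] at h1 h2
      have g1 := hle i h1
      have g2 := hle j h2
      rcases g1 with g1 | g1
      · exact wedge_disj (fun a b => ht3 i j a b hij) g1 g2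
      · exact wedge_disj (fun a b => ht3 i j a b hij) g1 g2.symm
end

section
/- Every set S of exactly 6 points in the plane in general position admits 3 pairwise edge-disjoint plane spanning trees. -/
namespace SixPts

/-! ### Combinatorial search -/

/-- Bit position of a sorted triple. -/
def idx (i j k : ℕ) : ℕ := Nat.add (Nat.mul 6 (Nat.add (Nat.mul 6 i) j)) k

/-- Sign of the sorted triple recorded in the mask. -/
def tb (m i j k : ℕ) : Bool :=
  Nat.beq (Nat.land (Nat.shiftRight m (idx i j k)) 1) 1

theorem tb_eq (m i j k : ℕ) : tb m i j k = Nat.testBit m (idx i j k) := by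
  have h : tb m i j k = Nat.beq ((m >>> idx i j k) &&& 1) 1 := rfl
  rw [h, Nat.testBit_eq_decide_div_mod_eq, Nat.and_one_is_mod, Nat.shiftRight_eq_div_pow,
    Bool.eq_iff_iff]
  simp

/-- Evaluates its argument before passing it on (a help for the kernel). -/
def force {α : Type} (m : ℕ) (k : ℕ → α) : α :=
  Nat.rec (k 0) (fun n _ => k (Nat.succ n)) m

theorem force_eq {α : Type} (m : ℕ) (k : ℕ → α) : force m k = k m := by
  cases m <;> rfl

/-- Sign of an arbitrary triple. -/
def chi (m a b c : ℕ) : Bool :=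
  bif Nat.blt a b then
    bif Nat.blt b c then tb m a b c
    else bif Nat.blt a c then !(tb m a c b) else tb m c a b
  else
    bif Nat.blt a c then !(tb m b a c)
    else bif Nat.blt b c then tb m b c a else !(tb m c b a)

/-- Combinatorial test that segments `ab` and `cd` do not cross. -/
def noncross (m a b c d : ℕ) : Bool :=
  (Nat.beq a c || Nat.beq a d || Nat.beq b c || Nat.beq b d) ||
  (!(xor (chi m a b c) (chi m a b d))) || !(xor (chi m c d a) (chi m c d b))

/-- Parent function of a rooted tree given as a list. -/
def par (l : List ℕ) (v : ℕ) : ℕ := l.getD v 0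

def planeTree (m : ℕ) (l : List ℕ) : Bool :=
  match l with
  | [_, a, b, c, d, e] =>
    noncross m 1 a 2 b && (noncross m 1 a 3 c && (noncross m 1 a 4 d && (noncross m 1 a 5 e &&
    (noncross m 2 b 3 c && (noncross m 2 b 4 d && (noncross m 2 b 5 e &&
    (noncross m 3 c 4 d && (noncross m 3 c 5 e && noncross m 4 d 5 e))))))))
  | _ => false

theorem planeTree_all (m : ℕ) (l : List ℕ) (h : planeTree m l = true) (u v : ℕ)
    (hu : u ≠ 0) (huv : u < v) (hv : v < 6) :
    noncross m u (par l u) v (par l v) = true := by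
  unfold planeTree at h
  split at h
  · simp only [Bool.and_eq_true] at h
    obtain ⟨h1, h2, h3, h4, h5, h6, h7, h8, h9, h10⟩ := h
    interval_cases v <;> interval_cases u <;> first | exact absurd rfl hu | assumption
  · cases h

/-- A compiled crossing test. -/
abbrev Tst : Type := ℕ × ℕ × Bool × ℕ × ℕ × Bool

/-- Bit of a mask. -/
def bit (m n : ℕ) : Bool := Nat.beq (Nat.land (Nat.shiftRight m n) 1) 1

def evalT (m : ℕ) : Tst → Bool
  | (a, b, s, c, d, t) =>
    (!(xor (bit m a) (xor (bit m b) s))) || !(xor (bit m c) (xor (bit m d) t))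

/-- Bit position of an arbitrary triple. -/
def pos (a b c : ℕ) : ℕ :=
  bif Nat.blt a b then
    bif Nat.blt b c then idx a b c
    else bif Nat.blt a c then idx a c b else idx c a b
  else
    bif Nat.blt a c then idx b a c
    else bif Nat.blt b c then idx b c a else idx c b a

/-- Parity of an arbitrary triple. -/
def neg (a b c : ℕ) : Bool :=
  bif Nat.blt a b then
    bif Nat.blt b c then false
    else bif Nat.blt a c then true else false
  else
    bif Nat.blt a c then true
    else bif Nat.blt b c then false else true

theorem chi_eq_bit (m a b c : ℕ) : chi m a b c = xor (bit m (pos a b c)) (neg a b c) := by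
  unfold chi pos neg
  cases Nat.blt a b <;> cases Nat.blt b c <;> cases Nat.blt a c <;> simp [tb, bit]

/-- Compile a crossing test. -/
def compile (a b c d : ℕ) : Tst :=
  (pos a b c, pos a b d, xor (neg a b c) (neg a b d),
   pos c d a, pos c d b, xor (neg c d a) (neg c d b))

theorem evalT_compile (m a b c d : ℕ) (h : evalT m (compile a b c d) = true) :
    noncross m a b c d = true := by
  simp only [evalT, compile] at h
  simp only [noncross, chi_eq_bit]
  revert h
  generalize bit m (pos a b c) = x1
  generalize bit m (pos a b d) = x2
  generalize bit m (pos c d a) = x3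
  generalize bit m (pos c d b) = x4
  generalize neg a b c = y1
  generalize neg a b d = y2
  generalize neg c d a = y3
  generalize neg c d b = y4
  generalize (Nat.beq a c || Nat.beq a d || Nat.beq b c || Nat.beq b d) = z
  revert x1 x2 x3 x4 y1 y2 y3 y4 z
  decide

/-- The partitions used, with the compiled crossing tests of each. -/
def tab : List (List (List ℕ) × List Tst) :=
  [([[0, 0, 4, 1, 1, 4], [0, 5, 5, 0, 0, 0], [0, 2, 0, 2, 3, 3]],
    [(65, 11, true, 10, 29, true), (94, 52, true, 51, 58, true), (59, 11, true, 9, 23, true),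
     (101, 17, true, 16, 29, true), (95, 17, true, 15, 23, true), (8, 10, false, 52, 16, false),
     (11, 10, false, 65, 29, false), (59, 58, false, 137, 65, false), (52, 51, false, 58, 94, false),
     (53, 51, false, 59, 95, false), (16, 15, false, 94, 22, false), (17, 15, false, 95, 23, false)]),
   ([[0, 0, 5, 5, 1, 1], [0, 3, 3, 0, 0, 0], [0, 2, 0, 4, 2, 4]],
    [(101, 53, true, 52, 65, true), (58, 9, false, 10, 22, false), (94, 15, false, 16, 22, false),
     (137, 59, true, 58, 65, true), (59, 9, false, 11, 23, false), (95, 15, false, 17, 23, false),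
     (8, 11, false, 53, 17, false), (9, 11, false, 59, 23, false), (51, 52, false, 58, 94, false),
     (53, 52, false, 65, 101, false), (15, 16, false, 94, 22, false), (17, 16, false, 101, 29, false)]),
   ([[0, 0, 1, 1, 3, 3], [0, 5, 5, 2, 2, 0], [0, 4, 0, 0, 0, 4]],
    [(59, 53, false, 51, 95, false), (58, 10, true, 9, 22, true), (65, 53, false, 52, 101, false),
     (95, 15, false, 23, 17, false), (52, 10, true, 8, 16, true), (101, 16, false, 29, 17, false),
     (10, 9, false, 58, 22, false), (11, 9, false, 59, 23, false), (52, 51, false, 94, 58, false),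
     (53, 51, false, 95, 59, false), (17, 16, false, 101, 29, false), (23, 22, false, 137, 29, false)]),
   ([[0, 0, 4, 0, 0, 4], [0, 5, 5, 1, 1, 0], [0, 2, 0, 2, 3, 3]],
    [(101, 53, true, 52, 65, true), (59, 9, false, 23, 11, false), (94, 16, true, 15, 22, true),
     (95, 53, true, 51, 59, true), (65, 10, false, 29, 11, false), (8, 10, false, 52, 16, false),
     (11, 10, false, 65, 29, false), (23, 22, false, 137, 29, false), (52, 51, false, 58, 94, false),
     (53, 51, false, 59, 95, false), (16, 15, false, 94, 22, false), (17, 15, false, 95, 23, false)]),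
   ([[0, 0, 1, 1, 3, 3], [0, 4, 4, 2, 0, 2], [0, 5, 0, 0, 5, 0]],
    [(65, 52, true, 53, 101, true), (94, 15, false, 22, 16, false), (59, 11, true, 9, 23, true),
     (53, 11, true, 8, 17, true), (10, 9, false, 58, 22, false), (11, 9, false, 59, 23, false),
     (52, 51, false, 94, 58, false), (53, 51, false, 95, 59, false), (58, 52, false, 51, 94, false),
     (29, 16, true, 101, 17, true), (16, 17, false, 101, 29, false), (22, 23, false, 137, 29, false)]),
   ([[0, 0, 4, 4, 1, 1], [0, 3, 3, 0, 0, 0], [0, 2, 0, 5, 5, 2]],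
    [(94, 15, false, 16, 22, false), (137, 58, false, 59, 65, false), (101, 52, false, 53, 65, false),
     (59, 9, false, 11, 23, false), (8, 10, false, 52, 16, false), (9, 10, false, 58, 22, false),
     (58, 9, false, 10, 22, false), (95, 15, false, 17, 23, false), (51, 53, false, 59, 95, false),
     (52, 53, false, 65, 101, false), (15, 17, false, 95, 23, false), (16, 17, false, 101, 29, false)]),
   ([[0, 0, 0, 4, 0, 4], [0, 3, 3, 0, 2, 2], [0, 5, 1, 5, 1, 0]],
    [(65, 10, false, 29, 11, false), (58, 51, true, 52, 94, true), (23, 15, true, 95, 17, true),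
     (9, 10, false, 58, 22, false), (11, 10, false, 65, 29, false), (15, 16, false, 94, 22, false),
     (17, 16, false, 101, 29, false), (59, 51, true, 53, 95, true), (22, 15, true, 94, 16, true),
     (51, 53, false, 95, 59, false), (53, 8, false, 17, 11, false), (137, 59, true, 58, 65, true)]),
   ([[0, 0, 5, 0, 5, 0], [0, 4, 4, 1, 0, 1], [0, 2, 0, 2, 3, 3]],
    [(94, 52, true, 51, 58, true), (95, 17, true, 15, 23, true), (8, 11, false, 53, 17, false),
     (10, 11, false, 65, 29, false), (22, 23, false, 137, 29, false), (101, 52, false, 53, 65, false),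
     (58, 9, false, 22, 10, false), (29, 10, true, 65, 11, true), (52, 51, false, 58, 94, false),
     (53, 51, false, 59, 95, false), (16, 15, false, 94, 22, false), (17, 15, false, 95, 23, false)]),
   ([[0, 0, 5, 0, 5, 0], [0, 3, 0, 2, 1, 1], [0, 2, 4, 4, 0, 3]],
    [(95, 17, true, 15, 23, true), (95, 51, false, 59, 53, false), (101, 94, true, 95, 137, true),
     (8, 11, false, 53, 17, false), (10, 11, false, 65, 29, false), (22, 23, false, 137, 29, false),
     (51, 9, true, 8, 15, true), (16, 8, true, 52, 10, true), (17, 8, true, 53, 11, true),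
     (94, 51, false, 58, 52, false), (51, 52, false, 58, 94, false), (52, 8, false, 10, 16, false),
     (53, 51, false, 59, 95, false), (29, 22, true, 137, 23, true)]),
   ([[0, 0, 3, 0, 3, 0], [0, 4, 4, 1, 0, 1], [0, 2, 0, 5, 5, 2]],
    [(94, 52, true, 51, 58, true), (29, 10, true, 65, 11, true), (137, 22, false, 29, 23, false),
     (8, 9, false, 51, 15, false), (10, 9, false, 58, 22, false), (95, 15, false, 17, 23, false),
     (101, 52, false, 53, 65, false), (58, 9, false, 22, 10, false), (51, 53, false, 59, 95, false),
     (52, 53, false, 65, 101, false), (15, 17, false, 95, 23, false), (16, 17, false, 101, 29, false)]),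
   ([[0, 0, 3, 0, 0, 3], [0, 5, 5, 1, 1, 0], [0, 2, 0, 4, 2, 4]],
    [(101, 53, true, 52, 65, true), (29, 22, true, 137, 23, true), (59, 9, false, 23, 11, false),
     (8, 9, false, 51, 15, false), (11, 9, false, 59, 23, false), (94, 15, false, 16, 22, false),
     (95, 53, true, 51, 59, true), (65, 10, false, 29, 11, false), (51, 52, false, 58, 94, false),
     (53, 52, false, 65, 101, false), (15, 16, false, 94, 22, false), (17, 16, false, 101, 29, false)]),
   ([[0, 0, 3, 1, 1, 4], [0, 2, 4, 0, 0, 2], [0, 5, 0, 5, 3, 0]],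
    [(94, 51, false, 52, 58, false), (94, 16, true, 15, 22, true), (8, 9, false, 51, 15, false),
     (11, 10, false, 65, 29, false), (95, 94, false, 101, 137, false), (59, 58, false, 137, 65, false),
     (51, 8, false, 9, 15, false), (52, 8, false, 10, 16, false), (23, 15, true, 95, 17, true),
     (29, 16, true, 101, 17, true), (53, 11, true, 8, 17, true), (65, 59, false, 58, 137, false),
     (15, 17, false, 95, 23, false), (16, 15, false, 94, 22, false), (137, 22, false, 29, 23, false)]),
   ([[0, 0, 0, 0, 3, 3], [0, 5, 5, 1, 1, 0], [0, 2, 4, 2, 0, 4]],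
    [(101, 53, true, 52, 65, true), (59, 9, false, 23, 11, false), (10, 9, false, 58, 22, false),
     (11, 9, false, 59, 23, false), (16, 15, false, 94, 22, false), (17, 15, false, 95, 23, false),
     (95, 53, true, 51, 59, true), (65, 10, false, 29, 11, false), (52, 8, false, 10, 16, false),
     (53, 52, false, 65, 101, false), (94, 15, false, 22, 16, false), (95, 94, false, 137, 101, false)]),
   ([[0, 0, 5, 1, 3, 1], [0, 4, 4, 2, 0, 3], [0, 2, 0, 0, 5, 0]],
    [(58, 52, false, 51, 94, false), (8, 11, false, 53, 17, false), (10, 9, false, 58, 22, false),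
     (95, 53, true, 51, 59, true), (101, 95, false, 94, 137, false), (137, 58, false, 65, 59, false),
     (65, 58, true, 59, 137, true), (101, 94, true, 95, 137, true), (94, 15, false, 22, 16, false),
     (29, 22, true, 137, 23, true), (51, 8, false, 9, 15, false), (52, 53, false, 65, 101, false),
     (53, 8, false, 11, 17, false), (16, 17, false, 101, 29, false), (22, 23, false, 137, 29, false)]),
   ([[0, 0, 4, 5, 1, 1], [0, 3, 5, 2, 0, 0], [0, 2, 0, 0, 3, 4]],
    [(51, 59, true, 53, 95, true), (8, 10, false, 52, 16, false), (9, 11, false, 59, 23, false),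
     (94, 101, true, 95, 137, true), (101, 52, false, 53, 65, false), (137, 59, true, 58, 65, true),
     (58, 9, false, 10, 22, false), (59, 9, false, 11, 23, false), (101, 17, true, 16, 29, true),
     (94, 15, false, 22, 16, false), (95, 15, false, 23, 17, false), (51, 8, false, 9, 15, false),
     (52, 51, false, 58, 94, false), (53, 52, false, 65, 101, false), (16, 15, false, 94, 22, false),
     (17, 16, false, 101, 29, false), (23, 22, false, 137, 29, false)]),
   ([[0, 0, 4, 1, 1, 4], [0, 5, 5, 2, 3, 0], [0, 2, 0, 0, 0, 3]],
    [(8, 10, false, 52, 16, false), (11, 10, false, 65, 29, false), (94, 52, true, 51, 58, true),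
     (59, 58, false, 137, 65, false), (59, 53, false, 51, 95, false), (65, 59, false, 58, 137, false),
     (101, 95, false, 94, 137, false), (95, 15, false, 23, 17, false), (137, 22, false, 29, 23, false),
     (51, 8, false, 9, 15, false), (52, 8, false, 10, 16, false), (53, 51, false, 59, 95, false),
     (17, 15, false, 95, 23, false), (29, 22, true, 137, 23, true)])]

def good (m : ℕ) : Bool := tab.any fun e => e.2.all fun t => evalT m t

/-- The test for the pair is listed or superfluous. -/
def listed (ts : List Tst) (a b c d : ℕ) : Bool :=
  (Nat.beq a c || Nat.beq a d || Nat.beq b c || Nat.beq b d) ||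
    decide (compile a b c d ∈ ts)

theorem listed_sound (m : ℕ) (ts : List Tst) (hts : ∀ t ∈ ts, evalT m t = true)
    (a b c d : ℕ) (h : listed ts a b c d = true) : noncross m a b c d = true := by
  simp only [listed, Bool.or_eq_true (_ || _) (decide _), decide_eq_true_eq] at h
  rcases h with h | h
  · simp only [noncross, h, Bool.true_or]
  · exact evalT_compile m a b c d (hts _ h)

def listedTree (ts : List Tst) (l : List ℕ) : Bool :=
  match l with
  | [_, a, b, c, d, e] =>
    listed ts 1 a 2 b && (listed ts 1 a 3 c && (listed ts 1 a 4 d && (listed ts 1 a 5 e &&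
    (listed ts 2 b 3 c && (listed ts 2 b 4 d && (listed ts 2 b 5 e &&
    (listed ts 3 c 4 d && (listed ts 3 c 5 e && listed ts 4 d 5 e))))))))
  | _ => false

theorem listedTree_sound (m : ℕ) (ts : List Tst) (hts : ∀ t ∈ ts, evalT m t = true)
    (l : List ℕ) (h : listedTree ts l = true) : planeTree m l = true := by
  unfold listedTree at h
  split at h
  · simp only [Bool.and_eq_true] at h
    obtain ⟨h1, h2, h3, h4, h5, h6, h7, h8, h9, h10⟩ := h
    simp only [planeTree, Bool.and_eq_true]
    have k := listed_sound m ts hts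
    exact ⟨k _ _ _ _ h1, k _ _ _ _ h2, k _ _ _ _ h3, k _ _ _ _ h4, k _ _ _ _ h5,
      k _ _ _ _ h6, k _ _ _ _ h7, k _ _ _ _ h8, k _ _ _ _ h9, k _ _ _ _ h10⟩
  · cases h

set_option maxRecDepth 100000 in
theorem tab_listed : (tab.all fun e => e.1.all fun l => listedTree e.2 l) = true := by
  decide +kernel

/-- At most one sign change. -/
def monoB (a b c d : Bool) : Bool :=
  match a, b, c, d with
  | true, false, true, _ => false
  | true, false, false, true => false
  | true, true, false, true => false
  | false, true, false, _ => false
  | false, true, true, false => false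
  | false, false, true, false => false
  | _, _, _, _ => true

def ok (t : ℕ × ℕ × ℕ) (m : ℕ) : Bool :=
  (List.range t.1).all fun i =>
    monoB (tb m i t.1 t.2.1) (tb m i t.1 t.2.2) (tb m i t.2.1 t.2.2) (tb m t.1 t.2.1 t.2.2)

def triples : List (ℕ × ℕ × ℕ) :=
  [(0, 1, 2), (0, 1, 3), (0, 2, 3), (1, 2, 3), (0, 1, 4), (0, 2, 4), (1, 2, 4), (0, 3, 4), (1, 3, 4), (2, 3, 4), (0, 1, 5), (0, 2, 5), (1, 2, 5), (0, 3, 5), (1, 3, 5), (2, 3, 5), (0, 4, 5), (1, 4, 5), (2, 4, 5), (3, 4, 5)]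

def search : List (ℕ × ℕ × ℕ) → ℕ → Bool
  | [], m => good m
  | t :: ts, m =>
    (!(ok t m) || search ts m) &&
    force (m ||| 2 ^ idx t.1 t.2.1 t.2.2) fun m' => (!(ok t m') || search ts m')

def orderOK : List (ℕ × ℕ × ℕ) → List (ℕ × ℕ × ℕ) → Bool
  | [], _ => true
  | t :: ts, proc =>
    (proc.all fun s => decide (idx s.1 s.2.1 s.2.2 ≠ idx t.1 t.2.1 t.2.2)) &&
    ((List.range t.1).all fun i =>
      decide ((i, t.1, t.2.1) ∈ proc) && decide ((i, t.1, t.2.2) ∈ proc) &&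
        decide ((i, t.2.1, t.2.2) ∈ proc)) &&
    orderOK ts (t :: proc)

set_option maxRecDepth 100000 in
theorem search_ok : search triples 0 = true := by decide +kernel

set_option maxRecDepth 100000 in
theorem order_ok : orderOK triples [] = true := by decide +kernel

theorem search_sound (f : ℕ → ℕ → ℕ → Bool) (all : List (ℕ × ℕ × ℕ))
    (hf : ∀ t ∈ all, ∀ i < t.1,
      monoB (f i t.1 t.2.1) (f i t.1 t.2.2) (f i t.2.1 t.2.2) (f t.1 t.2.1 t.2.2) = true) :
    ∀ (ts proc : List (ℕ × ℕ × ℕ)) (m : ℕ),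
      (∀ t ∈ ts, t ∈ all) →
      (∀ t ∈ proc, tb m t.1 t.2.1 t.2.2 = f t.1 t.2.1 t.2.2) →
      (∀ n, (∀ t ∈ proc, idx t.1 t.2.1 t.2.2 ≠ n) → m.testBit n = false) →
      orderOK ts proc = true → search ts m = true →
      ∃ m', (∀ t, t ∈ proc ∨ t ∈ ts → tb m' t.1 t.2.1 t.2.2 = f t.1 t.2.1 t.2.2) ∧
        good m' = true := by
  intro ts
  induction ts with
  | nil =>
    intro proc m _ h1 _ _ hs
    exact ⟨m, by simpa using h1, by simpa [search] using hs⟩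
  | cons t ts ih =>
    intro proc m hall h1 h2 ho hs
    simp only [orderOK, Bool.and_eq_true, List.all_eq_true, decide_eq_true_eq] at ho
    obtain ⟨⟨ho1, ho2⟩, ho3⟩ := ho
    simp only [search, force_eq, Bool.and_eq_true, Bool.or_eq_true, Bool.not_eq_true'] at hs
    obtain ⟨hs1, hs2⟩ := hs
    have hnew := h2 (idx t.1 t.2.1 t.2.2) ho1
    have key : ∀ m', (∀ s ∈ t :: proc, tb m' s.1 s.2.1 s.2.2 = f s.1 s.2.1 s.2.2) →
        ok t m' = true := by
      intro m' h
      simp only [ok, List.all_eq_true]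
      intro i hi
      obtain ⟨⟨a1, a2⟩, a3⟩ := ho2 i hi
      have b1 := h _ (List.mem_cons_of_mem _ a1)
      have b2 := h _ (List.mem_cons_of_mem _ a2)
      have b3 := h _ (List.mem_cons_of_mem _ a3)
      have b4 := h t List.mem_cons_self
      simp only at b1 b2 b3 b4
      rw [b1, b2, b3, b4]
      exact hf t (hall t List.mem_cons_self) i (List.mem_range.1 hi)
    have fin : ∀ m', (∀ s ∈ t :: proc, tb m' s.1 s.2.1 s.2.2 = f s.1 s.2.1 s.2.2) →
        (∀ n, (∀ s ∈ t :: proc, idx s.1 s.2.1 s.2.2 ≠ n) → m'.testBit n = false) →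
        search ts m' = true →
        ∃ m', (∀ s, s ∈ proc ∨ s ∈ t :: ts → tb m' s.1 s.2.1 s.2.2 = f s.1 s.2.1 s.2.2) ∧
        good m' = true := by
      intro m' c1 c2 c3
      obtain ⟨m'', d1, d2⟩ := ih (t :: proc) m'
        (fun s hs => hall s (List.mem_cons_of_mem _ hs)) c1 c2 ho3 c3
      refine ⟨m'', fun s hs => d1 s ?_, d2⟩
      simp only [List.mem_cons] at hs ⊢
      tauto
    cases hft : f t.1 t.2.1 t.2.2 with
    | false =>
      have c1 : ∀ s ∈ t :: proc, tb m s.1 s.2.1 s.2.2 = f s.1 s.2.1 s.2.2 := by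
        intro s hs
        rcases List.mem_cons.1 hs with rfl | hs
        · rw [hft, tb_eq]; exact hnew
        · exact h1 s hs
      refine fin m c1 (fun n hn => h2 n fun s hs => hn s (List.mem_cons_of_mem _ hs)) ?_
      rcases hs1 with h | h
      · rw [key m c1] at h; cases h
      · exact h
    | true =>
      have c1 : ∀ s ∈ t :: proc,
          tb (m ||| 2 ^ idx t.1 t.2.1 t.2.2) s.1 s.2.1 s.2.2 = f s.1 s.2.1 s.2.2 := by
        intro s hs
        rcases List.mem_cons.1 hs with rfl | hs
        · rw [hft]; simp [tb_eq, Nat.testBit_or]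
        · rw [← h1 s hs]
          have := ho1 s hs
          simp [tb_eq, Nat.testBit_or, this.symm]
      refine fin _ c1 (fun n hn => ?_) ?_
      · rw [Nat.testBit_or, h2 n fun s hs => hn s (List.mem_cons_of_mem _ hs),
          Nat.testBit_two_pow]
        simpa using hn t List.mem_cons_self
      · rcases hs2 with h | h
        · rw [key _ c1] at h; cases h
        · exact h

/-! ### Trees from parent lists -/

def treeRel (l : List ℕ) (a b : Fin 6) : Prop := (b : ℕ) = par l a

def treeG (l : List ℕ) : SimpleGraph (Fin 6) := SimpleGraph.fromRel (treeRel l)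

/-- Validity of a parent list. -/
def validTree (l : List ℕ) : Bool :=
  (List.range 6).all fun v => decide (par l v < 6) && decide ((par l)^[5] v = 0)

def isEdge (l : List ℕ) (a b : ℕ) : Bool :=
  decide (a ≠ b) && (decide (b = par l a) || decide (a = par l b))

def disjTree (l l' : List ℕ) : Bool :=
  (List.range 6).all fun a => (List.range 6).all fun b => !(isEdge l a b && isEdge l' a b)

def validPart (p : List (List ℕ)) : Bool :=
  match p with
  | [a, b, c] => validTree a && validTree b && validTree c &&
      disjTree a b && disjTree a c && disjTree b c && decide (par a 0 = 0) &&
      decide (par b 0 = 0) && decide (par c 0 = 0)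
  | _ => false

set_option maxRecDepth 100000 in
theorem tab_valid : (tab.all fun e => validPart e.1) = true := by decide +kernel

theorem treeG_adj (l : List ℕ) (a b : Fin 6) :
    (treeG l).Adj a b ↔ isEdge l a b = true := by
  simp [treeG, treeRel, isEdge, SimpleGraph.fromRel_adj, Fin.ext_iff]

theorem treeG_isTree (l : List ℕ) (h : validTree l = true) (h0 : par l 0 = 0) :
    (treeG l).IsTree := by
  simp only [validTree, List.all_eq_true, Bool.and_eq_true, decide_eq_true_eq,
    List.mem_range] at h
  have hr : ∀ (n : ℕ) (v w : Fin 6), (w : ℕ) = (par l)^[n] v → (treeG l).Reachable v w := by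
    intro n
    induction n with
    | zero => intro v w hw; rw [Fin.ext (a := w) (b := v) (by simpa using hw)]
    | succ n ih =>
      intro v w hw
      rw [Function.iterate_succ_apply] at hw
      have hlt := (h v v.2).1
      have h2 := ih ⟨par l v, hlt⟩ w hw
      refine SimpleGraph.Reachable.trans ?_ h2
      by_cases hv : v = ⟨par l v, hlt⟩
      · rw [← hv]
      · apply SimpleGraph.Adj.reachable
        simp only [treeG, SimpleGraph.fromRel_adj]
        exact ⟨hv, Or.inl rfl⟩
  have hc : (treeG l).Connected := by
    rw [SimpleGraph.connected_iff_exists_forall_reachable]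
    exact ⟨0, fun v => (hr 5 v 0 (by simpa using (h v v.2).2.symm)).symm⟩
  rw [SimpleGraph.isTree_iff_connected_and_card]
  refine ⟨hc, le_antisymm ?_ hc.card_vert_le_card_edgeSet_add_one⟩
  have hsub : (treeG l).edgeSet ⊆
      Set.range (fun v : Fin 5 => s(v.succ, (⟨par l v.succ, (h _ v.succ.2).1⟩ : Fin 6))) := by
    intro e
    induction e using Sym2.ind with
    | _ a b =>
      intro hab
      rw [SimpleGraph.mem_edgeSet] at hab
      simp only [treeG, SimpleGraph.fromRel_adj, treeRel] at hab
      obtain ⟨hne, hab⟩ := hab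
      have aux : ∀ x y : Fin 6, x ≠ y → (y : ℕ) = par l x → s(x, y) ∈
          Set.range (fun v : Fin 5 =>
            s(v.succ, (⟨par l v.succ, (h _ v.succ.2).1⟩ : Fin 6))) := by
        intro x y hxy hy
        have hx : x ≠ 0 := by
          rintro rfl
          apply hxy
          apply Fin.ext
          rw [hy]
          exact h0.symm
        obtain ⟨v, rfl⟩ := Fin.exists_succ_eq.2 hx
        refine ⟨v, ?_⟩
        have : y = ⟨par l v.succ, (h _ v.succ.2).1⟩ := Fin.ext hy
        rw [this]
      rcases hab with hab | hab
      · exact aux a b hne hab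
      · rw [Sym2.eq_swap]; exact aux b a hne.symm hab
  have h1 : Nat.card (treeG l).edgeSet ≤ 5 := by
    have := Set.ncard_le_ncard hsub (Set.finite_range _)
    rw [← Set.image_univ] at this
    have h3 := Set.ncard_image_le (f := fun v : Fin 5 =>
            s(v.succ, (⟨par l v.succ, (h _ v.succ.2).1⟩ : Fin 6))) (Set.finite_univ)
    rw [Set.ncard_univ, Nat.card_eq_fintype_card, Fintype.card_fin] at h3
    rw [Nat.card_coe_set_eq]
    exact this.trans h3
  rw [Nat.card_eq_fintype_card (α := Fin 6), Fintype.card_fin]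
  omega

/-! ### Geometry -/

def D (p q r : Pt) : ℝ := (q.1 - p.1) * (r.2 - p.2) - (q.2 - p.2) * (r.1 - p.1)

theorem D_ne (p q r : Pt) (hpq : p ≠ q) (h : ¬ Collinear ℝ ({p, q, r} : Set Pt)) :
    D p q r ≠ 0 := by
  intro hD
  apply h
  rw [collinear_iff_of_mem (p₀ := p) (by simp)]
  refine ⟨q - p, ?_⟩
  have hr : ∃ t : ℝ, r = t • (q - p) +ᵥ p := by
    unfold D at hD
    by_cases h1 : q.1 - p.1 = 0
    · have h2 : q.2 - p.2 ≠ 0 := by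
        intro h2
        exact hpq (Prod.ext (by linarith) (by linarith))
      refine ⟨(r.2 - p.2) / (q.2 - p.2), Prod.ext ?_ ?_⟩
      · rw [h1] at hD
        have : r.1 - p.1 = 0 := by
          rcases mul_eq_zero.1 (show (q.2 - p.2) * (r.1 - p.1) = 0 by linarith) with h | h
          · exact absurd h h2
          · exact h
        simp [h1]; linarith
      · simp; field_simp; ring
    · refine ⟨(r.1 - p.1) / (q.1 - p.1), Prod.ext ?_ ?_⟩
      · simp; field_simp; ring
      · simp; field_simp; linarith
  intro x hx
  simp only [Set.mem_insert_iff, Set.mem_singleton_iff] at hx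
  rcases hx with rfl | rfl | rfl
  · exact ⟨0, by simp⟩
  · exact ⟨1, by simp⟩
  · exact hr

theorem seg_share (a b c : Pt) (h : D a b c ≠ 0) :
    openSegment ℝ a b ∩ openSegment ℝ a c = ∅ := by
  ext x
  simp only [Set.mem_inter_iff, Set.mem_empty_iff_false, iff_false, not_and]
  rintro ⟨s, t, hs, ht, hst, rfl⟩ ⟨u, v, hu, hv, huv, hx⟩
  have e1 := congrArg Prod.fst hx
  have e2 := congrArg Prod.snd hx
  simp only [Prod.fst_add, Prod.snd_add, Prod.smul_fst, Prod.smul_snd, smul_eq_mul] at e1 e2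
  apply h
  obtain rfl : s = 1 - t := by linarith
  obtain rfl : u = 1 - v := by linarith
  have k1 : v * (c.1 - a.1) = t * (b.1 - a.1) := by linarith
  have k2 : v * (c.2 - a.2) = t * (b.2 - a.2) := by linarith
  have : v * D a b c = 0 := by
    unfold D
    linear_combination (b.1 - a.1) * k2 - (b.2 - a.2) * k1
  exact (mul_eq_zero.1 this).resolve_left hv.ne'

theorem seg_side (a b c d : Pt) (h : 0 < D a b c * D a b d) :
    openSegment ℝ a b ∩ openSegment ℝ c d = ∅ := by
  ext x
  simp only [Set.mem_inter_iff, Set.mem_empty_iff_false, iff_false, not_and]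
  rintro ⟨s, t, hs, ht, hst, rfl⟩ ⟨u, v, hu, hv, huv, hx⟩
  have e1 := congrArg Prod.fst hx
  have e2 := congrArg Prod.snd hx
  simp only [Prod.fst_add, Prod.snd_add, Prod.smul_fst, Prod.smul_snd, smul_eq_mul] at e1 e2
  obtain rfl : s = 1 - t := by linarith
  obtain rfl : u = 1 - v := by linarith
  have : (1 - v) * D a b c + v * D a b d = 0 := by
    unfold D
    linear_combination (b.1 - a.1) * e2 - (b.2 - a.2) * e1
  rcases pos_and_pos_or_neg_and_neg_of_mul_pos h with ⟨h1, h2⟩ | ⟨h1, h2⟩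
  · have := mul_pos hu h1
    have := mul_pos hv h2
    linarith
  · have := mul_neg_of_pos_of_neg hu h1
    have := mul_neg_of_pos_of_neg hv h2
    linarith

theorem comb (u v w a b d : ℝ) (hu : 0 ≤ u) (hv : 0 ≤ v) (hw : 0 ≤ w) (hvw : 0 < v + w)
    (h : u * b = v * a + w * d) (hb : b ≠ 0) (ha : a ≠ 0) (hd : d ≠ 0)
    (h1 : decide (0 < a) = decide (0 < d)) : decide (0 < b) = decide (0 < a) := by
  rw [decide_eq_decide] at h1 ⊢
  rcases lt_or_gt_of_ne ha with ha | ha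
  · have hd' : d < 0 := lt_of_le_of_ne (not_lt.1 fun h => absurd (h1.2 h) ha.not_gt) hd
    refine ⟨fun hb => ?_, fun h => absurd h ha.not_gt⟩
    exfalso
    have : 0 ≤ u * b := mul_nonneg hu hb.le
    rcases hv.lt_or_eq with hv' | hv'
    · nlinarith [mul_pos hv' (neg_pos.2 ha), mul_nonneg hw (neg_pos.2 hd').le]
    · have hw' : 0 < w := by linarith
      nlinarith [mul_pos hw' (neg_pos.2 hd'), mul_nonneg hv (neg_pos.2 ha).le]
  · have hd' : 0 < d := h1.1 ha
    refine ⟨fun _ => ha, fun _ => ?_⟩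
    by_contra hb'
    have : u * b ≤ 0 := mul_nonpos_of_nonneg_of_nonpos hu (not_lt.1 hb')
    rcases hv.lt_or_eq with hv' | hv'
    · nlinarith [mul_pos hv' ha, mul_nonneg hw hd'.le]
    · have hw' : 0 < w := by linarith
      nlinarith [mul_pos hw' hd', mul_nonneg hv ha.le]

theorem mono_geom (p q r s : Pt) (h1 : p.1 ≤ q.1) (h2 : q.1 ≤ r.1) (h3 : r.1 ≤ s.1)
    (ha : D p q r ≠ 0) (hb : D p q s ≠ 0) (hc : D p r s ≠ 0) (hd : D q r s ≠ 0) :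
    monoB (decide (0 < D p q r)) (decide (0 < D p q s)) (decide (0 < D p r s))
      (decide (0 < D q r s)) = true := by
  have n1 : 0 < r.1 - p.1 := by
    rcases (h1.trans h2).lt_or_eq with h | h
    · linarith
    · exfalso; apply ha
      have : q.1 = p.1 := le_antisymm (by linarith) h1
      unfold D; rw [this, ← h]; ring
  have n2 : 0 < s.1 - q.1 := by
    rcases (h2.trans h3).lt_or_eq with h | h
    · linarith
    · exfalso; apply hd
      have : r.1 = q.1 := le_antisymm (by linarith) h2
      unfold D; rw [this, ← h]; ring
  -- b between a and c
  have k1 := comb (r.1 - p.1) (s.1 - p.1) (q.1 - p.1) (D p q r) (D p q s) (D p r s)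
    (by linarith) (by linarith) (by linarith) (by linarith) (by unfold D; ring) hb ha hc
  have k2 := comb (r.1 - q.1) (s.1 - q.1) (q.1 - p.1) (D p q r) (D p q s) (D q r s)
    (by linarith) (by linarith) (by linarith) (by linarith) (by unfold D; ring) hb ha hd
  have k3 := comb (r.1 - q.1) (s.1 - r.1) (r.1 - p.1) (D p q r) (D p r s) (D q r s)
    (by linarith) (by linarith) (by linarith) (by linarith) (by unfold D; ring) hc ha hd
  have k4 := comb (s.1 - q.1) (s.1 - r.1) (s.1 - p.1) (D p q s) (D p r s) (D q r s)
    (by linarith) (by linarith) (by linarith) (by linarith) (by unfold D; ring) hc hb hd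
  revert k1 k2 k3 k4
  generalize decide (0 < D p q r) = a
  generalize decide (0 < D p q s) = b
  generalize decide (0 < D p r s) = c
  generalize decide (0 < D q r s) = d
  revert a b c d
  decide

theorem dec_neg (x y : ℝ) (h : x = -y) (hx : x ≠ 0) : (!(decide (0 < x))) = decide (0 < y) := by
  subst h
  rcases lt_or_gt_of_ne hx with h | h
  · have : 0 < y := by linarith
    simp [this, this.le]
  · have : y < 0 := by linarith
    simp [this, this.le]

/-- The combinatorial sign agrees with the geometric one. -/
theorem chi_eq (P : ℕ → Pt) (m : ℕ)
    (hne : ∀ a b c, a < 6 → b < 6 → c < 6 → a ≠ b → a ≠ c → b ≠ c → D (P a) (P b) (P c) ≠ 0)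
    (hm : ∀ a b c, a < b → b < c → c < 6 → tb m a b c = decide (0 < D (P a) (P b) (P c)))
    (a b c : ℕ) (ha : a < 6) (hb : b < 6) (hc : c < 6) (hab : a ≠ b) (hac : a ≠ c) (hbc : b ≠ c) :
    chi m a b c = decide (0 < D (P a) (P b) (P c)) := by
  have hB : ∀ x y, Nat.blt x y = decide (x < y) := by
    intro x y; rw [Bool.eq_iff_iff]; simp [Nat.blt_eq]
  simp only [chi, hB, Bool.cond_decide]
  split_ifs with h1 h2 h3 h4 h5
  · exact hm a b c h1 h2 hc
  · rw [hm a c b h3 (by omega) hb]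
    exact dec_neg _ _ (by unfold D; ring) (hne _ _ _ ha hc hb hac hab hbc.symm)
  · rw [hm c a b (by omega) h1 hb]
    congr 2; unfold D; ring
  · rw [hm b a c (by omega) h4 hc]
    exact dec_neg _ _ (by unfold D; ring) (hne _ _ _ hb ha hc hab.symm hbc hac)
  · rw [hm b c a h5 (by omega) ha]
    congr 2; unfold D; ring
  · rw [hm c b a (by omega) (by omega) ha]
    exact dec_neg _ _ (by unfold D; ring) (hne _ _ _ hc hb ha hbc.symm hac.symm hab.symm)

theorem same_sign (x y : ℝ) (hx : x ≠ 0) (hy : y ≠ 0)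
    (h : (!(xor (decide (0 < x)) (decide (0 < y)))) = true) : 0 < x * y := by
  rcases lt_or_gt_of_ne hx with h1 | h1 <;> rcases lt_or_gt_of_ne hy with h2 | h2
  · exact mul_pos_of_neg_of_neg h1 h2
  · simp [h1.not_gt, h2] at h
  · simp [h2.not_gt, h1] at h
  · exact mul_pos h1 h2

theorem noncross_sound (P : ℕ → Pt) (m : ℕ)
    (hne : ∀ a b c, a < 6 → b < 6 → c < 6 → a ≠ b → a ≠ c → b ≠ c → D (P a) (P b) (P c) ≠ 0)
    (hm : ∀ a b c, a < b → b < c → c < 6 → tb m a b c = decide (0 < D (P a) (P b) (P c)))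
    (a b c d : ℕ) (ha : a < 6) (hb : b < 6) (hc : c < 6) (hd : d < 6)
    (hab : a ≠ b) (hcd : c ≠ d) (hs : ¬ (a = c ∧ b = d)) (hs' : ¬ (a = d ∧ b = c))
    (h : noncross m a b c d = true) :
    openSegment ℝ (P a) (P b) ∩ openSegment ℝ (P c) (P d) = ∅ := by
  by_cases e1 : a = c
  · subst e1
    exact seg_share _ _ _ (hne a b d ha hb hd hab hcd (fun h => hs ⟨rfl, h⟩))
  by_cases e2 : a = d
  · subst e2
    rw [openSegment_symm ℝ (P c)]
    exact seg_share _ _ _ (hne a b c ha hb hc hab e1 (fun h => hs' ⟨rfl, h⟩))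
  by_cases e3 : b = c
  · subst e3
    rw [openSegment_symm ℝ (P a)]
    exact seg_share _ _ _ (hne b a d hb ha hd hab.symm hcd e2)
  by_cases e4 : b = d
  · subst e4
    rw [openSegment_symm ℝ (P a), openSegment_symm ℝ (P c)]
    exact seg_share _ _ _ (hne b a c hb ha hc hab.symm e3 e1)
  have hE : ∀ x y, x ≠ y → Nat.beq x y = false := by
    intro x y hxy
    rw [Bool.eq_false_iff]
    exact fun h => hxy (Nat.eq_of_beq_eq_true h)
  have n1 := hne a b c ha hb hc hab e1 e3
  have n2 := hne a b d ha hb hd hab e2 e4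
  have n3 := hne c d a hc hd ha hcd (Ne.symm e1) (Ne.symm e2)
  have n4 := hne c d b hc hd hb hcd (Ne.symm e3) (Ne.symm e4)
  simp only [noncross, hE _ _ e1, hE _ _ e2, hE _ _ e3, hE _ _ e4, Bool.false_or,
    Bool.or_eq_true,
    chi_eq P m hne hm a b c ha hb hc hab e1 e3, chi_eq P m hne hm a b d ha hb hd hab e2 e4,
    chi_eq P m hne hm c d a hc hd ha hcd (Ne.symm e1) (Ne.symm e2),
    chi_eq P m hne hm c d b hc hd hb hcd (Ne.symm e3) (Ne.symm e4)] at h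
  rcases h with h | h
  · exact seg_side _ _ _ _ (same_sign _ _ n1 n2 h)
  · rw [Set.inter_comm]
    exact seg_side _ _ _ _ (same_sign _ _ n3 n4 h)

theorem plane_sound (P : ℕ → Pt) (m : ℕ) (l : List ℕ)
    (hne : ∀ a b c, a < 6 → b < 6 → c < 6 → a ≠ b → a ≠ c → b ≠ c → D (P a) (P b) (P c) ≠ 0)
    (hm : ∀ a b c, a < b → b < c → c < 6 → tb m a b c = decide (0 < D (P a) (P b) (P c)))
    (hv : validTree l = true) (h0 : par l 0 = 0) (h : planeTree m l = true)
    (a b c d : Fin 6) (hab : (treeG l).Adj a b) (hcd : (treeG l).Adj c d)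
    (hne' : s(a, b) ≠ s(c, d)) :
    openSegment ℝ (P a) (P b) ∩ openSegment ℝ (P c) (P d) = ∅ := by
  simp only [validTree, List.all_eq_true, Bool.and_eq_true, decide_eq_true_eq,
    List.mem_range] at hv
  -- directed version, ordered
  have main : ∀ a c : ℕ, a < 6 → c < 6 → a < c → par l a ≠ a → par l c ≠ c →
      ¬ (a = par l c ∧ par l a = c) →
      openSegment ℝ (P a) (P (par l a)) ∩ openSegment ℝ (P c) (P (par l c)) = ∅ := by
    intro a c ha hc hac hpa hpc hn
    have ha0 : a ≠ 0 := by rintro rfl; exact hpa h0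
    have := planeTree_all m l h a c ha0 hac hc
    exact noncross_sound P m hne hm a (par l a) c (par l c) ha (hv a ha).1 hc (hv c hc).1
      hpa.symm hpc.symm (fun h => by omega) hn this
  have main2 : ∀ a b c d : Fin 6, a ≠ b → c ≠ d → (b : ℕ) = par l a → (d : ℕ) = par l c →
      s(a, b) ≠ s(c, d) →
      openSegment ℝ (P a) (P b) ∩ openSegment ℝ (P c) (P d) = ∅ := by
    intro a b c d hab hcd hb hd hs
    have hab' : (a : ℕ) ≠ b := fun h => hab (Fin.ext h)
    have hcd' : (c : ℕ) ≠ d := fun h => hcd (Fin.ext h)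
    have hn : ¬ ((a : ℕ) = d ∧ (b : ℕ) = c) := by
      rintro ⟨h1, h2⟩
      rw [Fin.ext h1, Fin.ext h2] at hs
      exact hs Sym2.eq_swap
    rcases lt_trichotomy (a : ℕ) c with hlt | heq | hgt
    · have := main a c a.2 c.2 hlt (hb ▸ hab'.symm) (hd ▸ hcd'.symm) (by rw [← hb, ← hd]; exact hn)
      rwa [← hb, ← hd] at this
    · exfalso
      apply hs
      have h1 : a = c := Fin.ext heq
      have h2 : b = d := Fin.ext (by rw [hb, hd, heq])
      rw [h1, h2]
    · have := main c a c.2 a.2 hgt (hd ▸ hcd'.symm) (hb ▸ hab'.symm)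
        (by rw [← hb, ← hd]; exact fun h => hn ⟨h.2.symm, h.1.symm⟩)
      rw [← hb, ← hd] at this
      rwa [Set.inter_comm]
  simp only [treeG, SimpleGraph.fromRel_adj, treeRel] at hab hcd
  obtain ⟨n1, hab⟩ := hab
  obtain ⟨n2, hcd⟩ := hcd
  rcases hab with hab | hab <;> rcases hcd with hcd | hcd
  · exact main2 a b c d n1 n2 hab hcd hne'
  · rw [openSegment_symm ℝ (P c)]
    exact main2 a b d c n1 n2.symm hab hcd (by rwa [Sym2.eq_swap (a := d)])
  · rw [openSegment_symm ℝ (P a)]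
    exact main2 b a c d n1.symm n2 hab hcd (by rwa [Sym2.eq_swap (a := b)])
  · rw [openSegment_symm ℝ (P a), openSegment_symm ℝ (P c)]
    exact main2 b a d c n1.symm n2.symm hab hcd
      (by rwa [Sym2.eq_swap (a := b), Sym2.eq_swap (a := d)])

theorem triples_sorted : ∀ t ∈ triples, t.1 < t.2.1 ∧ t.2.1 < t.2.2 ∧ t.2.2 < 6 := by decide

theorem triples_all (a b c : ℕ) (hab : a < b) (hbc : b < c) (hc : c < 6) :
    (a, b, c) ∈ triples := by
  have : ∀ c ∈ List.range 6, ∀ b ∈ List.range c, ∀ a ∈ List.range b, (a, b, c) ∈ triples := by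
    decide
  exact this c (List.mem_range.2 hc) b (List.mem_range.2 hbc) a (List.mem_range.2 hab)

/-- The combinatorial core, for six sorted points. -/
theorem exists_part (P : ℕ → Pt)
    (hmono : ∀ a b, a < b → b < 6 → (P a).1 ≤ (P b).1)
    (hne : ∀ a b c, a < 6 → b < 6 → c < 6 → a ≠ b → a ≠ c → b ≠ c → D (P a) (P b) (P c) ≠ 0) :
    ∃ m : ℕ, (∀ a b c, a < b → b < c → c < 6 → tb m a b c = decide (0 < D (P a) (P b) (P c))) ∧
      good m = true := by
  obtain ⟨m, h1, h2⟩ := search_sound (fun a b c => decide (0 < D (P a) (P b) (P c))) triples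
    (by
      intro t ht i hi
      obtain ⟨s1, s2, s3⟩ := triples_sorted t ht
      apply mono_geom
      · exact hmono _ _ hi (by omega)
      · exact hmono _ _ s1 (by omega)
      · exact hmono _ _ s2 (by omega)
      all_goals apply hne <;> omega)
    triples [] 0 (fun _ h => h) (by simp) (by simp) order_ok search_ok
  exact ⟨m, fun a b c hab hbc hc => h1 (a, b, c) (Or.inr (triples_all a b c hab hbc hc)), h2⟩

end SixPts

open SixPts

/-- Every set of exactly 6 points in general position admits 3 pairwise edge-disjoint plane spanning trees. -/
theorem three_trees_six_points (S : Finset Pt) (n : ℕ) (hS : S.card = n) (hgp : GenPos S)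
    (hn : n = 6) :
    ∃ T : Fin 3 → SimpleGraph {x // x ∈ S},
      (∀ i, IsPlaneSpanningTree (T i)) ∧
      (∀ i j, i ≠ j → Disjoint (T i).edgeSet (T j).edgeSet) := by
  subst hn
  -- sort the points by their first coordinate
  let e0 : Fin 6 ≃ {x // x ∈ S} := (S.equivFinOfCardEq hS).symm
  let g : Fin 6 → ℝ := fun i => (e0 i : Pt).1
  let e : Fin 6 ≃ {x // x ∈ S} := (Tuple.sort g).trans e0
  have hmon : Monotone fun i => (e i : Pt).1 := Tuple.monotone_sort g
  let P : ℕ → Pt := fun n => if h : n < 6 then (e ⟨n, h⟩ : Pt) else 0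
  have hP : ∀ i : Fin 6, P i = (e i : Pt) := fun i => by simp [P]
  have hPn : ∀ (n : ℕ) (h : n < 6), P n = (e ⟨n, h⟩ : Pt) := fun n h => by simp [P, h]
  have hinj : ∀ (a b : ℕ), a < 6 → b < 6 → a ≠ b → P a ≠ P b := by
    intro a b ha hb hab h
    rw [hPn a ha, hPn b hb] at h
    have := e.injective (Subtype.ext h)
    simp only [Fin.mk.injEq] at this
    exact hab this
  have hmem : ∀ a, a < 6 → P a ∈ S := fun a ha => by rw [hPn a ha]; exact (e _).2
  have hne : ∀ a b c, a < 6 → b < 6 → c < 6 → a ≠ b → a ≠ c → b ≠ c →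
      D (P a) (P b) (P c) ≠ 0 := by
    intro a b c ha hb hc hab hac hbc
    exact D_ne _ _ _ (hinj a b ha hb hab) (hgp _ (hmem a ha) _ (hmem b hb) _ (hmem c hc)
      (hinj a b ha hb hab) (hinj a c ha hc hac) (hinj b c hb hc hbc))
  have hmono : ∀ a b, a < b → b < 6 → (P a).1 ≤ (P b).1 := by
    intro a b hab hb
    rw [hPn a (hab.trans hb), hPn b hb]
    exact hmon (show (⟨a, hab.trans hb⟩ : Fin 6) ≤ ⟨b, hb⟩ from hab.le)
  obtain ⟨m, hm, hg⟩ := exists_part P hmono hne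
  simp only [good, List.any_eq_true] at hg
  obtain ⟨⟨p, ts⟩, hp, hts⟩ := hg
  have hval := List.all_eq_true.1 tab_valid _ hp
  simp only at hval
  have hg : (p.all fun l => planeTree m l) = true := by
    have h1 := List.all_eq_true.1 tab_listed _ hp
    rw [List.all_eq_true] at h1 hts ⊢
    exact fun l hl => listedTree_sound m ts hts l (h1 l hl)
  have main : ∀ l, validTree l = true → par l 0 = 0 → planeTree m l = true →
      IsPlaneSpanningTree ((treeG l).comap e.symm) := by
    intro l hv h0 hpl
    refine ⟨?_, ?_⟩
    · exact (SimpleGraph.Iso.comap e.symm (treeG l)).isTree_iff.2 (treeG_isTree l hv h0)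
    · intro a b c d hab hcd hs
      have := plane_sound P m l hne hm hv h0 hpl (e.symm a) (e.symm b) (e.symm c) (e.symm d)
        hab hcd (by
          intro h
          apply hs
          have := congrArg (Sym2.map e) h
          simpa using this)
      simpa [hP] using this
  have disj : ∀ l l', disjTree l l' = true →
      Disjoint ((treeG l).comap e.symm).edgeSet ((treeG l').comap e.symm).edgeSet := by
    intro l l' h
    simp only [disjTree, List.all_eq_true, List.mem_range] at h
    rw [Set.disjoint_left]
    intro x
    induction x using Sym2.ind with
    | _ a b =>
      intro h1 h2
      rw [SimpleGraph.mem_edgeSet, SimpleGraph.comap_adj, treeG_adj] at h1 h2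
      have := h _ (e.symm a).2 _ (e.symm b).2
      rw [h1, h2] at this
      cases this
  unfold validPart at hval
  split at hval
  · rename_i a b c
    simp only [Bool.and_eq_true, decide_eq_true_eq] at hval
    obtain ⟨⟨⟨⟨⟨⟨⟨⟨va, vb⟩, vc⟩, dab⟩, dac⟩, dbc⟩, a0⟩, b0⟩, c0⟩ := hval
    simp only [List.all_cons, List.all_nil, Bool.and_true, Bool.and_eq_true] at hg
    obtain ⟨ga, gb, gc⟩ := hg
    have Ta := main a va a0 ga
    have Tb := main b vb b0 gb
    have Tc := main c vc c0 gc
    refine ⟨![(treeG a).comap e.symm, (treeG b).comap e.symm, (treeG c).comap e.symm], ?_, ?_⟩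
    · intro i
      fin_cases i
      · exact Ta
      · exact Tb
      · exact Tc
    · intro i j hij
      fin_cases i <;> fin_cases j
      · exact absurd rfl hij
      · exact disj a b dab
      · exact disj a c dac
      · exact (disj a b dab).symm
      · exact absurd rfl hij
      · exact disj b c dbc
      · exact (disj a c dac).symm
      · exact (disj b c dbc).symm
      · exact absurd rfl hij
  · cases hval
end

section
/- Every set S of n ≥ 6 points in the plane in general position admits at least 3 pairwise edge-disjoint plane spanning trees. -/
/-! ### Orientation -/

def ori (p q r : Pt) : ℝ := (q.1 - p.1) * (r.2 - p.2) - (q.2 - p.2) * (r.1 - p.1)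

/-- A sheared first coordinate. -/
def hh (t : ℝ) (p : Pt) : ℝ := p.1 + t * p.2

lemma ori_ne_zero {S : Finset Pt} (hgp : GenPos S) {p q r : Pt} (hp : p ∈ S) (hq : q ∈ S)
    (hr : r ∈ S) (hpq : p ≠ q) (hpr : p ≠ r) (hqr : q ≠ r) : ori p q r ≠ 0 := by
  intro h0
  apply hgp p hp q hq r hr hpq hpr hqr
  rw [collinear_iff_of_mem (p₀ := p) (by simp)]
  refine ⟨q - p, ?_⟩
  have key : ∃ s : ℝ, r = s • (q - p) +ᵥ p := by
    unfold ori at h0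
    by_cases h1 : q.1 - p.1 = 0
    · have h2 : q.2 - p.2 ≠ 0 := by
        intro h2
        exact hpq (Prod.ext (by linarith) (by linarith))
      refine ⟨(r.2 - p.2) / (q.2 - p.2), Prod.ext ?_ ?_⟩
      · simp only [vadd_eq_add, Prod.fst_add, Prod.smul_fst, Prod.fst_sub, smul_eq_mul]
        rw [h1] at h0 ⊢
        have : r.1 - p.1 = 0 := by
          rcases mul_eq_zero.1 (show (q.2 - p.2) * (r.1 - p.1) = 0 by linarith) with h | h
          · exact absurd h h2
          · exact h
        linarith
      · simp only [vadd_eq_add, Prod.snd_add, Prod.smul_snd, Prod.snd_sub, smul_eq_mul]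
        field_simp
        ring
    · refine ⟨(r.1 - p.1) / (q.1 - p.1), Prod.ext ?_ ?_⟩
      · simp only [vadd_eq_add, Prod.fst_add, Prod.smul_fst, Prod.fst_sub, smul_eq_mul]
        field_simp
        ring
      · simp only [vadd_eq_add, Prod.snd_add, Prod.smul_snd, Prod.snd_sub, smul_eq_mul]
        field_simp
        linarith
  intro z hz
  simp only [Set.mem_insert_iff, Set.mem_singleton_iff] at hz
  rcases hz with rfl | rfl | rfl
  · exact ⟨0, by simp⟩
  · exact ⟨1, by simp⟩
  · exact key

lemma ori_rot (p q r : Pt) : ori p q r = ori q r p := by unfold ori; ring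
lemma ori_swap (p q r : Pt) : ori p q r = - ori p r q := by unfold ori; ring
lemma ori_swap' (p q r : Pt) : ori p q r = - ori q p r := by unfold ori; ring

lemma ori_comb (p q c d : Pt) (a b : ℝ) (h : a + b = 1) :
    ori p q (a • c + b • d) = a * ori p q c + b * ori p q d := by
  have : b = 1 - a := by linarith
  subst this
  simp only [ori, Prod.fst_add, Prod.smul_fst, Prod.snd_add, Prod.smul_snd, smul_eq_mul]
  ring

lemma ori_self1 (p q : Pt) : ori p q p = 0 := by unfold ori; ring
lemma ori_self2 (p q : Pt) : ori p q q = 0 := by unfold ori; ring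
lemma ori_self3 (p q : Pt) : ori p p q = 0 := by unfold ori; ring

/-- if `r`, `s` are weakly on the same side of `pq`, not both on it, then no crossing -/
lemma no_cross_of_pos {p q r s : Pt} (h1 : 0 ≤ ori p q r) (h2 : 0 ≤ ori p q s)
    (h3 : 0 < ori p q r ∨ 0 < ori p q s) :
    openSegment ℝ p q ∩ openSegment ℝ r s = ∅ := by
  ext z
  simp only [Set.mem_inter_iff, Set.mem_empty_iff_false, iff_false, not_and]
  rintro ⟨a, b, ha, hb, hab, rfl⟩ ⟨c, d, hc, hd, hcd, hz⟩
  have e1 := ori_comb p q p q a b hab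
  have e2 := ori_comb p q r s c d hcd
  rw [hz, e1, ori_self1, ori_self2] at e2
  rcases h3 with h | h
  · have := mul_pos hc h
    have := mul_nonneg hd.le h2
    linarith
  · have := mul_pos hd h
    have := mul_nonneg hc.le h1
    linarith

lemma no_cross_of_neg {p q r s : Pt} (h1 : ori p q r ≤ 0) (h2 : ori p q s ≤ 0)
    (h3 : ori p q r < 0 ∨ ori p q s < 0) :
    openSegment ℝ p q ∩ openSegment ℝ r s = ∅ := by
  rw [openSegment_symm ℝ p q]
  have e1 := ori_swap' p q r
  have e2 := ori_swap' p q s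
  apply no_cross_of_pos
  · linarith
  · linarith
  · rcases h3 with h | h
    · left; linarith
    · right; linarith

/-! ### Built trees -/

inductive BT : Finset Pt → Finset (Sym2 Pt) → Prop
  | single (p : Pt) : BT {p} ∅
  | leaf {S : Finset Pt} {E : Finset (Sym2 Pt)} {x w : Pt} (h : BT S E) (hx : x ∉ S)
      (hw : w ∈ S) : BT (insert x S) (insert s(x, w) E)

def GE (S : Finset Pt) (E : Finset (Sym2 Pt)) : SimpleGraph {x // x ∈ S} where
  Adj a b := a ≠ b ∧ s((a : Pt), (b : Pt)) ∈ E
  symm := ⟨fun a b h => ⟨h.1.symm, by rw [Sym2.eq_swap]; exact h.2⟩⟩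
  loopless := ⟨fun _ h => h.1 rfl⟩

lemma BT.mem {S : Finset Pt} {E : Finset (Sym2 Pt)} (h : BT S E) :
    ∀ a b, s(a, b) ∈ E → a ∈ S ∧ b ∈ S ∧ a ≠ b := by
  induction h with
  | single p => simp
  | @leaf S E x w h hx hw ih =>
    intro a b hab
    rw [Finset.mem_insert] at hab
    rcases hab with hab | hab
    · have hne : x ≠ w := fun e => hx (e ▸ hw)
      rcases Sym2.eq_iff.1 hab with ⟨rfl, rfl⟩ | ⟨rfl, rfl⟩
      · exact ⟨by simp, by simp [hw], hne⟩
      · exact ⟨by simp [hw], by simp, hne.symm⟩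
    · obtain ⟨h1, h2, h3⟩ := ih a b hab
      exact ⟨by simp [h1], by simp [h2], h3⟩

lemma BT.card {S : Finset Pt} {E : Finset (Sym2 Pt)} (h : BT S E) : E.card + 1 = S.card := by
  induction h with
  | single p => simp
  | @leaf S E x w h hx hw ih =>
    rw [Finset.card_insert_of_notMem hx, Finset.card_insert_of_notMem, ih]
    intro h'
    exact hx (h.mem _ _ h').1

lemma BT.connected {S : Finset Pt} {E : Finset (Sym2 Pt)} (h : BT S E) :
    (GE S E).Connected := by
  induction h with
  | single p =>
    have : Nonempty {x // x ∈ ({p} : Finset Pt)} := ⟨⟨p, by simp⟩⟩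
    refine ⟨?_⟩
    rintro ⟨a, ha⟩ ⟨b, hb⟩
    rw [Finset.mem_singleton] at ha hb
    subst ha; subst hb
    exact SimpleGraph.Reachable.refl _
  | @leaf S E x w h hx hw ih =>
    have hne : x ≠ w := fun e => hx (e ▸ hw)
    have : Nonempty {y // y ∈ insert x S} := ⟨⟨x, by simp⟩⟩
    let f : GE S E →g GE (insert x S) (insert s(x, w) E) :=
      { toFun := fun a => ⟨a.1, Finset.mem_insert_of_mem a.2⟩
        map_rel' := by
          intro a b hab
          refine ⟨?_, Finset.mem_insert_of_mem hab.2⟩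
          intro e
          apply hab.1
          exact Subtype.ext (Subtype.mk.inj e) }
    have hxw : (GE (insert x S) (insert s(x, w) E)).Adj ⟨x, by simp⟩ ⟨w, by simp [hw]⟩ := by
      refine ⟨?_, by simp⟩
      intro e
      exact hne (congrArg Subtype.val e)
    have key : ∀ a : {y // y ∈ insert x S},
        (GE (insert x S) (insert s(x, w) E)).Reachable a ⟨w, by simp [hw]⟩ := by
      rintro ⟨a, ha⟩
      rcases Finset.mem_insert.1 ha with rfl | ha'
      · exact hxw.reachable
      · exact (ih.preconnected ⟨a, ha'⟩ ⟨w, hw⟩).map f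
    exact ⟨fun a b => (key a).trans (key b).symm⟩

lemma BT.isTree {S : Finset Pt} {E : Finset (Sym2 Pt)} (h : BT S E) : (GE S E).IsTree := by
  rw [SimpleGraph.isTree_iff_connected_and_card]
  refine ⟨h.connected, ?_⟩
  apply le_antisymm
  · have h1 : Nat.card {x // x ∈ S} = S.card := by simp
    rw [h1, ← h.card]
    have h2 : Nat.card {e // e ∈ E} = E.card := by simp
    rw [← h2]
    apply Nat.add_le_add_right
    let g : (GE S E).edgeSet → {e // e ∈ E} := fun e => ⟨Sym2.map Subtype.val e.1, by
      obtain ⟨e, he⟩ := e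
      induction e using Sym2.ind with
      | _ a b => exact he.2⟩
    apply Nat.card_le_card_of_injective g
    intro a b hab
    apply Subtype.ext
    exact Sym2.map.injective Subtype.val_injective (congrArg Subtype.val hab)
  · exact h.connected.card_vert_le_card_edgeSet_add_one

def PlaneE (E : Finset (Sym2 Pt)) : Prop :=
  ∀ a b c d : Pt, s(a, b) ∈ E → s(c, d) ∈ E → s(a, b) ≠ s(c, d) →
    openSegment ℝ a b ∩ openSegment ℝ c d = ∅

def Pack (S : Finset Pt) : Prop :=
  ∃ E : Fin 3 → Finset (Sym2 Pt), (∀ i, BT S (E i)) ∧ (∀ i, PlaneE (E i)) ∧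
    ∀ i j, i ≠ j → Disjoint (E i) (E j)

lemma Pack.final {S : Finset Pt} (h : Pack S) :
    ∃ T : Fin 3 → SimpleGraph {x // x ∈ S},
      (∀ i, IsPlaneSpanningTree (T i)) ∧
      (∀ i j, i ≠ j → Disjoint (T i).edgeSet (T j).edgeSet) := by
  obtain ⟨E, h1, h2, h3⟩ := h
  refine ⟨fun i => GE S (E i), fun i => ⟨(h1 i).isTree, ?_⟩, ?_⟩
  · intro a b c d hab hcd hne
    apply h2 i _ _ _ _ hab.2 hcd.2
    intro e
    apply hne
    exact Sym2.map.injective Subtype.val_injective (by simpa using e)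
  · intro i j hij
    rw [Set.disjoint_left]
    intro e
    induction e using Sym2.ind with
    | _ a b =>
      intro he he'
      exact Finset.disjoint_left.1 (h3 i j hij) he.2 he'.2

/-! ### Inductive step -/

lemma plane_insert {E : Finset (Sym2 Pt)} {x w : Pt} (hE : PlaneE E)
    (hv : ∀ d e, s(d, e) ∈ E → openSegment ℝ x w ∩ openSegment ℝ d e = ∅) :
    PlaneE (insert s(x, w) E) := by
  intro a b c d hab hcd hne
  have hseg : ∀ {a b : Pt}, s(a, b) = s(x, w) → openSegment ℝ a b = openSegment ℝ x w := by
    intro a b h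
    rcases Sym2.eq_iff.1 h with ⟨rfl, rfl⟩ | ⟨rfl, rfl⟩
    · rfl
    · exact openSegment_symm ℝ _ _
  rcases Finset.mem_insert.1 hab with h1 | h1 <;> rcases Finset.mem_insert.1 hcd with h2 | h2
  · exact absurd (h1.trans h2.symm) hne
  · rw [hseg h1]; exact hv _ _ h2
  · rw [hseg h2, Set.inter_comm]; exact hv _ _ h1
  · exact hE _ _ _ _ h1 h2 hne

lemma ori_hh (t : ℝ) (x p q : Pt) : ori x p q =
    (hh t p - hh t x) * (q.2 - x.2) - (p.2 - x.2) * (hh t q - hh t x) := by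
  unfold ori hh; ring

/-- The key visibility lemma. -/
lemma third_visible {S : Finset Pt} {E : Finset (Sym2 Pt)} (x a b : Pt) (t : ℝ)
    (hx : ∀ p ∈ S, hh t x < hh t p)
    (hne : ∀ p ∈ S, ∀ q ∈ S, p ≠ q → ori x p q ≠ 0)
    (hgp : GenPos S)
    (ha : a ∈ S) (hb : b ∈ S) (hamin : ∀ p ∈ S, p ≠ a → 0 < ori x a p)
    (hbmax : ∀ p ∈ S, p ≠ b → 0 < ori x p b) 
    (hE : PlaneE E) (hmem : ∀ p q, s(p, q) ∈ E → p ∈ S ∧ q ∈ S ∧ p ≠ q)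
    (hnb : ∃ v, s(a, v) ∈ E) (hab : s(a, b) ∉ E) :
    ∃ c ∈ S, c ≠ a ∧ c ≠ b ∧
      ∀ d e, s(d, e) ∈ E → openSegment ℝ x c ∩ openSegment ℝ d e = ∅ := by
  -- the angular order around x
  have htrans : ∀ p ∈ S, ∀ q ∈ S, ∀ r ∈ S, 0 ≤ ori x p q → 0 < ori x q r → 0 < ori x p r := by
    intro p hp q hq r hr h1 h2
    have hp' := sub_pos.2 (hx p hp)
    have hq' := sub_pos.2 (hx q hq)
    have hr' := sub_pos.2 (hx r hr)
    have e : (hh t q - hh t x) * ori x p r =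
        (hh t r - hh t x) * ori x p q + (hh t p - hh t x) * ori x q r := by
      rw [ori_hh t x p r, ori_hh t x p q, ori_hh t x q r]; ring
    have h3 : 0 < (hh t q - hh t x) * ori x p r := by
      rw [e]
      have := mul_nonneg hr'.le h1
      have := mul_pos hp' h2
      linarith
    exact (mul_pos_iff_of_pos_left hq').1 h3
  have htrans' : ∀ p ∈ S, ∀ q ∈ S, ∀ r ∈ S, 0 < ori x p q → 0 ≤ ori x q r → 0 < ori x p r := by
    intro p hp q hq r hr h1 h2
    rcases h2.lt_or_eq with h2 | h2
    · exact htrans p hp q hq r hr h1.le h2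
    · by_cases hqr : q = r
      · exact hqr ▸ h1
      · exact absurd h2.symm (hne q hq r hr hqr)
  -- the nearest neighbour v of a
  obtain ⟨v, hav, hvmin⟩ : ∃ v, s(a, v) ∈ E ∧ ∀ w, s(a, w) ∈ E → ori a v w ≤ 0 := by
    let N := S.filter (fun v => s(a, v) ∈ E)
    have hN : N.Nonempty := by
      obtain ⟨v, hv⟩ := hnb
      exact ⟨v, Finset.mem_filter.2 ⟨(hmem _ _ hv).2.1, hv⟩⟩
    obtain ⟨v, hvN, hv⟩ := N.exists_min_image (fun w => (hh t w - hh t a) / ori x a w) hN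
    have hvN' := (Finset.mem_filter.1 hvN).2
    refine ⟨v, hvN', ?_⟩
    intro w hw
    have hwS := (hmem _ _ hw).2
    have hvS := (hmem _ _ hvN').2
    have h1 := hv w (Finset.mem_filter.2 ⟨hwS.1, hw⟩)
    have ow := hamin w hwS.1 hwS.2.symm
    have ov := hamin v hvS.1 hvS.2.symm
    rw [div_le_div_iff₀ ov ow] at h1
    have e : (hh t w - hh t a) * ori x a v - (hh t v - hh t a) * ori x a w
        = - (hh t a - hh t x) * ori a v w := by
      unfold ori hh; ring
    have h2 := sub_pos.2 (hx a ha)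
    by_contra h3
    push Not at h3
    have := mul_pos h2 h3
    linarith
  have hvS := (hmem _ _ hav).2.1
  have hva : v ≠ a := (hmem _ _ hav).2.2.symm
  have hvb : v ≠ b := by rintro rfl; exact hab hav
  have oxav := hamin v hvS hva
  -- the candidate c
  obtain ⟨c, hcS, hca, hcv1, hcv2, hcmin⟩ : ∃ c ∈ S, c ≠ a ∧ 0 ≤ ori a v c ∧ 0 ≤ ori x c v ∧
      ∀ p ∈ S, p ≠ a → 0 ≤ ori a v p → 0 ≤ ori x p v → 0 ≤ ori x c p := by
    let D := S.filter (fun p => p ≠ a ∧ 0 ≤ ori a v p ∧ 0 ≤ ori x p v)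
    have hD : D.Nonempty :=
      ⟨v, Finset.mem_filter.2 ⟨hvS, hva, (ori_self2 _ _).ge, (ori_self2 _ _).ge⟩⟩
    obtain ⟨c, hcD, hc⟩ := D.exists_min_image (fun p => (p.2 - x.2) / (hh t p - hh t x)) hD
    obtain ⟨hcS, h1, h2, h3⟩ := Finset.mem_filter.1 hcD
    refine ⟨c, hcS, h1, h2, h3, ?_⟩
    intro p hp h4 h5 h6
    have h7 := hc p (Finset.mem_filter.2 ⟨hp, h4, h5, h6⟩)
    rw [div_le_div_iff₀ (sub_pos.2 (hx c hcS)) (sub_pos.2 (hx p hp))] at h7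
    rw [ori_hh t]
    linarith
  refine ⟨c, hcS, hca, ?_, ?_⟩
  · rintro rfl
    have h1 := hbmax v hvS hvb
    have := ori_swap x c v
    linarith
  have oavx : 0 < ori a v x := by rw [← ori_rot]; exact oxav
  -- points of the open segment xc are strictly on the near side of av
  have main : ∀ d e, s(d, e) ∈ E → ori x c d < 0 → 0 < ori x c e →
      openSegment ℝ x c ∩ openSegment ℝ d e = ∅ := by
    intro d e hde hd he
    obtain ⟨hdS, heS, hdne⟩ := hmem _ _ hde
    by_contra hcon
    obtain ⟨z, hz1, hz2⟩ := Set.nonempty_iff_ne_empty.2 hcon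
    obtain ⟨α, β, hα, hβ, hαβ, rfl⟩ := hz1
    obtain ⟨γ, δ, hγ, hδ, hγδ, hz⟩ := hz2
    have hzav : 0 < ori a v (α • x + β • c) := by
      rw [ori_comb _ _ _ _ _ _ hαβ]
      have := mul_pos hα oavx
      have := mul_nonneg hβ.le hcv1
      linarith
    by_cases hda : d = a
    · subst hda
      have h1 := hvmin e hde
      rw [← hz, ori_comb _ _ _ _ _ _ hγδ, ori_self1] at hzav
      have := mul_nonneg hδ.le (neg_nonneg.2 h1)
      linarith
    · have odc : 0 < ori x d c := by have := ori_swap x d c; linarith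
      have odv : 0 < ori x d v := htrans' d hdS c hcS v hvS odc hcv2
      have oavd : ori a v d < 0 := by
        by_contra h
        push Not at h
        have := hcmin d hdS hda h odv.le
        linarith
      -- the crossing point of de with line av
      set z := α • x + β • c with hzdef
      have ozv : 0 ≤ ori x z v := by
        have e1 : ori x z v = - ori x v z := ori_swap _ _ _
        rw [e1, hzdef, ori_comb _ _ _ _ _ _ hαβ, ori_self1, ori_swap x v c]
        have := mul_nonneg hβ.le hcv2
        linarith
      have oaz : 0 < ori x a z := by
        rw [hzdef, ori_comb _ _ _ _ _ _ hαβ, ori_self1]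
        have := mul_pos hβ (hamin c hcS hca)
        linarith
      have oad : 0 < ori x a d := hamin d hdS hda
      -- y = μ d + ν z
      set A := ori a v z with hA
      set B := - ori a v d with hB
      have hBpos : 0 < B := by linarith
      have hAB : 0 < A + B := by linarith
      set μ := A / (A + B) with hμ
      set ν := B / (A + B) with hν
      have hμ0 : 0 < μ := div_pos hzav hAB
      have hν0 : 0 < ν := div_pos hBpos hAB
      have hμν : μ + ν = 1 := by rw [hμ, hν]; field_simp
      have oy1 : ori a v (μ • d + ν • z) = 0 := by
        rw [ori_comb _ _ _ _ _ _ hμν, ← hA, hμ, hν]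
        have : ori a v d = -B := by rw [hB]; ring
        rw [this]; field_simp; ring
      have oy2 : 0 < ori x a (μ • d + ν • z) := by
        rw [ori_comb _ _ _ _ _ _ hμν]
        have := mul_pos hμ0 oad
        have := mul_pos hν0 oaz
        linarith
      have oy3 : 0 < ori x (μ • d + ν • z) v := by
        rw [ori_swap, ori_comb _ _ _ _ _ _ hμν, ori_swap x v d, ori_swap x v z]
        have := mul_pos hμ0 odv
        have := mul_nonneg hν0.le ozv
        linarith
      set y := μ • d + ν • z with hy
      have hyde : y ∈ openSegment ℝ d e := by
        refine ⟨μ + ν * γ, ν * δ, by positivity, by positivity, ?_, ?_⟩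
        · calc μ + ν * γ + ν * δ = μ + ν * (γ + δ) := by ring
            _ = 1 := by rw [hγδ, mul_one, hμν]
        · rw [hy, ← hz]; module
      have hyav : y ∈ openSegment ℝ a v := by
        have hK := oxav
        have e0 : ori x a y + ori x y v = ori x a v - ori a v y := by unfold ori; ring
        have e0' : ori x a y + ori x y v = ori x a v := by rw [e0, oy1, sub_zero]
        refine ⟨ori x y v / ori x a v, ori x a y / ori x a v, div_pos oy3 hK, div_pos oy2 hK,
          ?_, ?_⟩
        · rw [← add_div, add_comm, e0', div_self hK.ne']
        · have e1 : ori x y v * (a.1 - x.1) + ori x a y * (v.1 - x.1)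
              = ori x a v * (y.1 - x.1) := by unfold ori; ring
          have e2 : ori x y v * (a.2 - x.2) + ori x a y * (v.2 - x.2)
              = ori x a v * (y.2 - x.2) := by unfold ori; ring
          apply Prod.ext
          · simp only [Prod.fst_add, Prod.smul_fst, smul_eq_mul]
            field_simp
            linear_combination e1 + x.1 * e0'
          · simp only [Prod.snd_add, Prod.smul_snd, smul_eq_mul]
            field_simp
            linear_combination e2 + x.2 * e0'
      have hdv : d ≠ v := by
        rintro rfl
        rw [ori_self2] at oavd
        exact lt_irrefl _ oavd
      have hnes : s(a, v) ≠ s(d, e) := by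
        intro h
        rcases Sym2.eq_iff.1 h with ⟨h1, _⟩ | ⟨_, h1⟩
        · exact hda h1.symm
        · exact hdv h1.symm
      have := hE a v d e hav hde hnes
      exact (Set.eq_empty_iff_forall_notMem.1 this y) ⟨hyav, hyde⟩
  intro d e hde
  obtain ⟨hdS, heS, hdne⟩ := hmem _ _ hde
  have hz : ∀ q ∈ S, q ≠ c → ori x c q < 0 ∨ 0 < ori x c q := fun q hq hqc =>
    lt_or_gt_of_ne (hne c hcS q hq hqc.symm)
  have self : ori x c c = 0 := ori_self2 _ _
  by_cases hdc : d = c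
  · subst hdc
    rcases hz e heS hdne.symm with h | h
    · exact no_cross_of_neg self.le h.le (Or.inr h)
    · exact no_cross_of_pos self.ge h.le (Or.inr h)
  by_cases hec : e = c
  · subst hec
    rcases hz d hdS hdne with h | h
    · exact no_cross_of_neg h.le self.le (Or.inl h)
    · exact no_cross_of_pos h.le self.ge (Or.inl h)
  rcases hz d hdS hdc with h | h <;> rcases hz e heS hec with h' | h'
  · exact no_cross_of_neg h.le h'.le (Or.inl h)
  · exact main d e hde h h'
  · rw [openSegment_symm ℝ d e]
    exact main e d (by rw [Sym2.eq_swap]; exact hde) h' h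
  · exact no_cross_of_pos h.le h'.le (Or.inl h)

/-- every vertex of a built tree with at least two vertices has a neighbour -/
lemma BT.neighbor {S : Finset Pt} {E : Finset (Sym2 Pt)} (h : BT S E) :
    2 ≤ S.card → ∀ a ∈ S, ∃ v, s(a, v) ∈ E := by
  induction h with
  | single p => simp
  | @leaf S E x w h hx hw ih =>
    intro _ a ha
    rcases Finset.mem_insert.1 ha with rfl | ha'
    · exact ⟨w, by simp⟩
    · by_cases haw : a = w
      · subst haw
        exact ⟨x, by rw [Sym2.eq_swap]; simp⟩
      · have : 2 ≤ S.card := by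
          have : 1 < S.card := Finset.one_lt_card.2 ⟨a, ha', w, hw, haw⟩
          exact this
        obtain ⟨v, hv⟩ := ih this a ha'
        exact ⟨v, by simp [hv]⟩

lemma pack_step {S : Finset Pt} {x : Pt} (t : ℝ) (hxS : x ∉ S)
    (hx : ∀ p ∈ S, hh t x < hh t p) (hgp : GenPos (insert x S)) (hcard : 2 ≤ S.card)
    (h : Pack S) : Pack (insert x S) := by
  obtain ⟨E, hBT, hpl, hdis⟩ := h
  have hne : ∀ p ∈ S, ∀ q ∈ S, p ≠ q → ori x p q ≠ 0 := by
    intro p hp q hq hpq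
    refine ori_ne_zero hgp (by simp) (by simp [hp]) (by simp [hq]) ?_ ?_ hpq
    · rintro rfl; exact hxS hp
    · rintro rfl; exact hxS hq
  have hgpS : GenPos S := fun p hp q hq r hr => hgp p (by simp [hp]) q (by simp [hq]) r (by simp [hr])
  have hSne : S.Nonempty := Finset.card_pos.1 (by omega)
  have cmp : ∀ p ∈ S, ∀ q ∈ S,
      (p.2 - x.2) / (hh t p - hh t x) ≤ (q.2 - x.2) / (hh t q - hh t x) → 0 ≤ ori x p q := by
    intro p hp q hq h
    rw [div_le_div_iff₀ (sub_pos.2 (hx p hp)) (sub_pos.2 (hx q hq))] at h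
    rw [ori_hh t]
    linarith
  obtain ⟨a, ha, hamin⟩ := S.exists_min_image (fun p => (p.2 - x.2) / (hh t p - hh t x)) hSne
  obtain ⟨b, hb, hbmax⟩ := S.exists_max_image (fun p => (p.2 - x.2) / (hh t p - hh t x)) hSne
  have hamin' : ∀ p ∈ S, p ≠ a → 0 < ori x a p := fun p hp hpa =>
    lt_of_le_of_ne (cmp a ha p hp (hamin p hp)) (hne a ha p hp hpa.symm).symm
  have hbmax' : ∀ p ∈ S, p ≠ b → 0 < ori x p b := fun p hp hpb =>
    lt_of_le_of_ne (cmp p hp b hb (hbmax p hp)) (hne p hp b hb hpb).symm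
  have hab : a ≠ b := by
    rintro rfl
    obtain ⟨p, hp, hpa⟩ := Finset.exists_mem_ne (show 1 < S.card by omega) a
    have h1 := hamin' p hp hpa
    have h2 := hbmax' p hp hpa
    have := ori_swap x a p
    linarith
  have visa : ∀ i d e, s(d, e) ∈ E i → openSegment ℝ x a ∩ openSegment ℝ d e = ∅ := by
    intro i d e hde
    obtain ⟨hd, he, hdne⟩ := (hBT i).mem _ _ hde
    have w : ∀ p ∈ S, 0 ≤ ori x a p := fun p hp => cmp a ha p hp (hamin p hp)
    apply no_cross_of_pos (w d hd) (w e he)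
    by_cases hda : d = a
    · right; exact hamin' e he (by rw [← hda]; exact hdne.symm)
    · left; exact hamin' d hd hda
  have visb : ∀ i d e, s(d, e) ∈ E i → openSegment ℝ x b ∩ openSegment ℝ d e = ∅ := by
    intro i d e hde
    obtain ⟨hd, he, hdne⟩ := (hBT i).mem _ _ hde
    have w : ∀ p ∈ S, ori x b p ≤ 0 := fun p hp => by
      have := cmp p hp b hb (hbmax p hp)
      rw [ori_swap]; linarith
    have wlt : ∀ p ∈ S, p ≠ b → ori x b p < 0 := fun p hp hpb => by
      have := hbmax' p hp hpb
      rw [ori_swap]; linarith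
    apply no_cross_of_neg (w d hd) (w e he)
    by_cases hdb : d = b
    · right; exact wlt e he (by rw [← hdb]; exact hdne.symm)
    · left; exact wlt d hd hdb
  -- choose the tree that avoids ab
  obtain ⟨i, j, k, hij, hik, hjk, hcov, hiab⟩ : ∃ i j k : Fin 3, i ≠ j ∧ i ≠ k ∧ j ≠ k ∧
      (∀ l, l = i ∨ l = j ∨ l = k) ∧ s(a, b) ∉ E i := by
    by_cases h0 : s(a, b) ∈ E 0
    · refine ⟨1, 0, 2, by decide, by decide, by decide, by decide, ?_⟩
      exact Finset.disjoint_left.1 (hdis 0 1 (by decide)) h0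
    · exact ⟨0, 1, 2, by decide, by decide, by decide, by decide, h0⟩
  obtain ⟨c, hc, hca, hcb, visc⟩ := third_visible x a b t hx hne hgpS ha hb hamin' hbmax'
    (hpl i) (hBT i).mem ((hBT i).neighbor hcard a ha) hiab
  obtain ⟨w, hwS, hwinj, hwvis⟩ : ∃ w : Fin 3 → Pt, (∀ l, w l ∈ S) ∧
      (∀ l m, l ≠ m → w l ≠ w m) ∧
      ∀ l d e, s(d, e) ∈ E l → openSegment ℝ x (w l) ∩ openSegment ℝ d e = ∅ := by
    refine ⟨fun l => if l = i then c else if l = j then a else b, ?_, ?_, ?_⟩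
    · intro l
      dsimp only
      split_ifs <;> assumption
    · intro l m hlm
      dsimp only
      rcases hcov l with rfl | rfl | rfl <;> rcases hcov m with rfl | rfl | rfl <;>
        simp_all [Ne.symm]
    · intro l
      rcases hcov l with rfl | rfl | rfl
      · simpa using visc
      · simpa [hij.symm] using visa _
      · simpa [hik.symm, hjk.symm] using visb _
  refine ⟨fun l => insert s(x, w l) (E l), fun l => (hBT l).leaf hxS (hwS l),
    fun l => plane_insert (hpl l) (hwvis l), ?_⟩
  intro l m hlm
  have hnot : ∀ l m, s(x, w l) ∉ E m := fun l m h => hxS ((hBT m).mem _ _ h).1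
  rw [Finset.disjoint_left]
  intro e he he'
  rcases Finset.mem_insert.1 he with rfl | he <;> rcases Finset.mem_insert.1 he' with h | h
  · rcases Sym2.eq_iff.1 h with ⟨_, h⟩ | ⟨h, _⟩
    · exact hwinj l m hlm h
    · exact hxS (h ▸ hwS m)
  · exact hnot _ _ h
  · subst h; exact hnot _ _ he
  · exact Finset.disjoint_left.1 (hdis l m hlm) he h

lemma exists_shear (S : Finset Pt) : ∃ t : ℝ, ∀ p ∈ S, ∀ q ∈ S, hh t p = hh t q → p = q := by
  obtain ⟨t, ht⟩ := Infinite.exists_notMem_finset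
    ((S ×ˢ S).image fun z : Pt × Pt => -(z.1.1 - z.2.1) / (z.1.2 - z.2.2))
  refine ⟨t, fun p hp q hq h => ?_⟩
  by_contra hpq
  unfold hh at h
  by_cases h2 : p.2 - q.2 = 0
  · apply hpq
    have h3 : p.2 = q.2 := by linarith
    rw [h3] at h
    exact Prod.ext (by linarith) h3
  · apply ht
    rw [Finset.mem_image]
    refine ⟨(p, q), by simp [hp, hq], ?_⟩
    dsimp only
    field_simp
    linarith

/-! ### Six points: exhaustive check over sign patterns -/

def trips : List (ℕ × ℕ × ℕ) :=
  [(0,1,2), (0,1,3), (0,2,3), (1,2,3), (0,1,4), (0,2,4), (1,2,4), (0,3,4), (1,3,4), (2,3,4),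
   (0,1,5), (0,2,5), (1,2,5), (0,3,5), (1,3,5), (2,3,5), (0,4,5), (1,4,5), (2,4,5), (3,4,5)]

def tidx (i j k : ℕ) : ℕ := i + j * (j - 1) / 2 + k * (k - 1) * (k - 2) / 6

def bt (acc i j k : ℕ) : Bool := acc.testBit (tidx i j k)

/-- at most one sign change -/
def quadOK (A B C D : Bool) : Bool :=
  (A == B && (B == C || C == D)) || (B == C && C == D)

/-- no violated quadruple among those completed by the `n`-th triple -/
def goodAt (n acc : ℕ) : Bool :=
  match trips.getD n (0, 0, 0) with
  | (j, k, l) => (List.range j).all fun i =>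
      quadOK (bt acc i j k) (bt acc i j l) (bt acc i k l) (bt acc j k l)

def sg (acc i j k : ℕ) : Bool :=
  if i < j then
    if j < k then bt acc i j k else if i < k then !bt acc i k j else bt acc k i j
  else
    if i < k then !bt acc j i k else if j < k then bt acc j k i else !bt acc k j i

def nc (acc : ℕ) (e f : ℕ × ℕ) : Bool :=
  (e.1 == f.1 || e.1 == f.2 || e.2 == f.1 || e.2 == f.2) ||
  (sg acc e.1 e.2 f.1 == sg acc e.1 e.2 f.2) || (sg acc f.1 f.2 e.1 == sg acc f.1 f.2 e.2)

def planeT (acc : ℕ) (t : List (ℕ × ℕ)) : Bool := t.all fun e => t.all fun f => nc acc e f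

abbrev Coloring : Type := List (ℕ × ℕ) × List (ℕ × ℕ) × List (ℕ × ℕ)

def colorings : List Coloring :=
  [([(1, 0), (3, 1), (4, 1), (2, 4), (5, 4)],
    [(2, 0), (1, 2), (3, 2), (4, 3), (5, 3)],
    [(3, 0), (4, 0), (5, 0), (1, 5), (2, 5)]),
   ([(1, 0), (2, 1), (3, 1), (4, 3), (5, 3)],
    [(2, 0), (3, 0), (4, 0), (1, 4), (5, 4)],
    [(5, 0), (1, 5), (2, 5), (3, 2), (4, 2)]),
   ([(1, 0), (4, 1), (5, 1), (2, 5), (3, 5)],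
    [(2, 0), (1, 2), (4, 2), (3, 4), (5, 4)],
    [(3, 0), (4, 0), (5, 0), (1, 3), (2, 3)]),
   ([(1, 0), (3, 0), (4, 0), (2, 4), (5, 4)],
    [(2, 0), (1, 2), (3, 2), (4, 3), (5, 3)],
    [(5, 0), (1, 5), (3, 1), (4, 1), (2, 5)]),
   ([(1, 0), (4, 0), (5, 0), (2, 5), (3, 5)],
    [(2, 0), (1, 2), (4, 2), (3, 4), (5, 4)],
    [(3, 0), (1, 3), (4, 1), (5, 1), (2, 3)]),
   ([(1, 0), (2, 0), (3, 0), (4, 3), (5, 3)],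
    [(4, 0), (1, 4), (2, 1), (3, 1), (5, 4)],
    [(5, 0), (1, 5), (2, 5), (3, 2), (4, 2)]),
   ([(1, 0), (2, 0), (4, 0), (3, 4), (5, 4)],
    [(3, 0), (1, 3), (2, 3), (4, 2), (5, 2)],
    [(5, 0), (1, 5), (2, 1), (4, 1), (3, 5)]),
   ([(1, 0), (3, 0), (5, 0), (2, 5), (4, 5)],
    [(2, 0), (1, 2), (3, 2), (4, 3), (5, 3)],
    [(4, 0), (1, 4), (3, 1), (5, 1), (2, 4)]),
   ([(1, 0), (3, 0), (5, 0), (2, 5), (4, 3)],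
    [(2, 0), (1, 2), (3, 1), (5, 1), (4, 5)],
    [(4, 0), (1, 4), (2, 4), (3, 2), (5, 3)]),
   ([(1, 0), (2, 0), (3, 0), (4, 3), (5, 3)],
    [(4, 0), (1, 4), (3, 1), (5, 1), (2, 4)],
    [(5, 0), (2, 5), (1, 2), (3, 2), (4, 5)]),
   ([(1, 0), (2, 0), (4, 0), (3, 4), (5, 4)],
    [(3, 0), (1, 3), (4, 1), (5, 1), (2, 3)],
    [(5, 0), (2, 5), (1, 2), (4, 2), (3, 5)]),
   ([(1, 0), (2, 0), (5, 0), (3, 5), (4, 3)],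
    [(3, 0), (1, 3), (2, 1), (5, 1), (4, 5)],
    [(4, 0), (1, 4), (2, 4), (3, 2), (5, 2)]),
   ([(1, 0), (2, 0), (3, 0), (4, 3), (5, 3)],
    [(4, 0), (2, 4), (1, 2), (3, 2), (5, 4)],
    [(5, 0), (1, 5), (3, 1), (4, 1), (2, 5)]),
   ([(1, 0), (2, 0), (4, 0), (3, 4), (5, 3)],
    [(3, 0), (1, 3), (2, 1), (4, 1), (5, 4)],
    [(5, 0), (1, 5), (2, 5), (3, 2), (4, 2)]),
   ([(1, 0), (2, 0), (5, 0), (3, 5), (4, 5)],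
    [(3, 0), (1, 3), (4, 1), (5, 1), (2, 3)],
    [(4, 0), (2, 4), (1, 2), (5, 2), (3, 4)]),
   ([(1, 0), (3, 0), (4, 0), (2, 4), (5, 3)],
    [(2, 0), (1, 2), (3, 1), (4, 1), (5, 4)],
    [(5, 0), (1, 5), (2, 5), (3, 2), (4, 3)])]

def okk (acc : ℕ) : Bool :=
  colorings.any fun c => planeT acc c.1 && (planeT acc c.2.1 && planeT acc c.2.2)

def search : ℕ → ℕ → ℕ → Bool
  | 0, _, acc => okk acc
  | f + 1, n, acc =>
    (!goodAt n acc || search f (n + 1) acc) &&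
    (!goodAt n (acc + 2 ^ n) || search f (n + 1) (acc + 2 ^ n))

lemma search_true : search 20 0 0 = true := by decide +kernel

lemma search_sound (σ : ℕ → Bool)
    (hσ : ∀ n acc, n < 20 → (∀ i < n + 1, acc.testBit i = σ i) → goodAt n acc = true) :
    ∀ f n acc, n + f = 20 → acc < 2 ^ n → (∀ i < n, acc.testBit i = σ i) →
      search f n acc = true → ∃ acc', (∀ i < 20, acc'.testBit i = σ i) ∧ okk acc' = true := by
  intro f
  induction f with
  | zero =>
    intro n acc hn _ h1 h2
    exact ⟨acc, fun i hi => h1 i (by omega), h2⟩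
  | succ f ih =>
    intro n acc hn hlt h1 h2
    simp only [search, Bool.and_eq_true, Bool.or_eq_true, Bool.not_eq_true'] at h2
    obtain ⟨hA, hB⟩ := h2
    have hp : (2:ℕ) ^ (n + 1) = 2 ^ n + 2 ^ n := by ring
    cases hs : σ n with
    | false =>
      have hb : ∀ i < n + 1, acc.testBit i = σ i := by
        intro i hi
        rcases Nat.lt_succ_iff_lt_or_eq.1 hi with h | rfl
        · exact h1 i h
        · rw [hs]; exact Nat.testBit_lt_two_pow hlt
      rcases hA with h | h
      · rw [hσ n acc (by omega) hb] at h; cases h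
      · exact ih (n + 1) acc (by omega) (by omega) hb h
    | true =>
      have hb : ∀ i < n + 1, (acc + 2 ^ n).testBit i = σ i := by
        intro i hi
        rw [Nat.add_comm]
        rcases Nat.lt_succ_iff_lt_or_eq.1 hi with h | rfl
        · rw [Nat.testBit_two_pow_add_gt h]; exact h1 i h
        · rw [Nat.testBit_two_pow_add_eq, Nat.testBit_lt_two_pow hlt, hs]; rfl
      rcases hB with h | h
      · rw [hσ n _ (by omega) hb] at h; cases h
      · exact ih (n + 1) _ (by omega) (by omega) hb h

/-- list of (child, parent) pairs describes a tree on `{0,…,5}` -/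
def validT : List ℕ → List (ℕ × ℕ) → Bool
  | vis, [] => (List.range 6).all fun i => vis.contains i
  | vis, (u, v) :: t => !vis.contains u && vis.contains v && decide (u < 6) && validT (u :: vis) t

def disjT (t u : List (ℕ × ℕ)) : Bool :=
  t.all fun e => u.all fun f => !((e.1 == f.1 && e.2 == f.2) || (e.1 == f.2 && e.2 == f.1))

def validC (c : Coloring) : Bool :=
  validT [0] c.1 && validT [0] c.2.1 && validT [0] c.2.2 &&
  disjT c.1 c.2.1 && disjT c.1 c.2.2 && disjT c.2.1 c.2.2

lemma colorings_valid : ∀ c ∈ colorings, validC c = true := by decide +kernel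

/-- all entries are below 6 -/
lemma validT_lt : ∀ (t : List (ℕ × ℕ)) (vis : List ℕ), (∀ i ∈ vis, i < 6) → validT vis t = true →
    ∀ e ∈ t, e.1 < 6 ∧ e.2 < 6 ∧ e.1 ≠ e.2 := by
  intro t
  induction t with
  | nil => intro vis _ _ e he; cases he
  | cons a t ih =>
    intro vis hv h e he
    obtain ⟨u, v⟩ := a
    simp only [validT, Bool.and_eq_true, Bool.not_eq_true', decide_eq_true_eq,
      List.contains_iff_mem] at h
    obtain ⟨⟨⟨h1, h2⟩, h3⟩, h4⟩ := h
    have h1' : u ∉ vis := by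
      intro h; rw [← List.contains_iff_mem, h1] at h; cases h
    rcases List.mem_cons.1 he with rfl | he
    · refine ⟨h3, hv v h2, ?_⟩
      rintro (rfl : u = v)
      exact h1' h2
    · refine ih (u :: vis) ?_ h4 e he
      intro i hi
      rcases List.mem_cons.1 hi with rfl | hi
      · exact h3
      · exact hv i hi

lemma validT_BT (p : ℕ → Pt) (hinj : ∀ i < 6, ∀ j < 6, p i = p j → i = j) :
    ∀ (t : List (ℕ × ℕ)) (vis : List ℕ) (E : Finset (Sym2 Pt)), (∀ i ∈ vis, i < 6) →
      validT vis t = true → BT (vis.toFinset.image p) E →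
      ∃ E', BT ((Finset.range 6).image p) E' ∧
        ∀ e, e ∈ E' ↔ e ∈ E ∨ ∃ a ∈ t, e = s(p a.1, p a.2) := by
  intro t
  induction t with
  | nil =>
    intro vis E hv h hE
    refine ⟨E, ?_, by simp⟩
    have : vis.toFinset = Finset.range 6 := by
      ext i
      rw [List.mem_toFinset, Finset.mem_range]
      refine ⟨hv i, fun hi => ?_⟩
      simp only [validT, List.all_eq_true, List.mem_range, List.contains_iff_mem] at h
      exact h i hi
    rwa [this] at hE
  | cons a t ih =>
    intro vis E hv h hE
    obtain ⟨u, v⟩ := a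
    simp only [validT, Bool.and_eq_true, Bool.not_eq_true', decide_eq_true_eq,
      List.contains_iff_mem] at h
    obtain ⟨⟨⟨h1, h2⟩, h3⟩, h4⟩ := h
    have h1' : u ∉ vis := by
      intro h; rw [← List.contains_iff_mem, h1] at h; cases h
    have hu : p u ∉ vis.toFinset.image p := by
      intro hm
      obtain ⟨w, hw, hwu⟩ := Finset.mem_image.1 hm
      rw [List.mem_toFinset] at hw
      have := hinj w (hv w hw) u h3 hwu
      exact h1' (this ▸ hw)
    have hvv : p v ∈ vis.toFinset.image p :=
      Finset.mem_image_of_mem p (List.mem_toFinset.2 h2)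
    have hE2 := hE.leaf hu hvv
    rw [← Finset.image_insert, ← List.toFinset_cons] at hE2
    obtain ⟨E', hE', hmem⟩ := ih (u :: vis) _ (by
      intro i hi
      rcases List.mem_cons.1 hi with rfl | hi
      · exact h3
      · exact hv i hi) h4 hE2
    refine ⟨E', hE', fun e => ?_⟩
    rw [hmem e, Finset.mem_insert, List.exists_mem_cons_iff, or_assoc, or_left_comm]

lemma signotope_aux (t : ℝ) {a b c d : Pt} (hab : hh t a < hh t b) (hbc : hh t b < hh t c)
    (hcd : hh t c < hh t d) (h1 : ori a b c ≠ 0) (h2 : ori a b d ≠ 0) (h3 : ori a c d ≠ 0)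
    (h4 : ori b c d ≠ 0) :
    quadOK (decide (0 < ori a b c)) (decide (0 < ori a b d)) (decide (0 < ori a c d))
      (decide (0 < ori b c d)) = true := by
  have e1 : (hh t c - hh t a) * ori a b d =
      (hh t d - hh t a) * ori a b c + (hh t b - hh t a) * ori a c d := by
    unfold ori hh; ring
  have e2 : (hh t c - hh t b) * ori a b d =
      (hh t d - hh t b) * ori a b c + (hh t b - hh t a) * ori b c d := by
    unfold ori hh; ring
  have e3 : (hh t c - hh t b) * ori a c d =
      (hh t d - hh t c) * ori a b c + (hh t c - hh t a) * ori b c d := by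
    unfold ori hh; ring
  have e4 : (hh t d - hh t b) * ori a c d =
      (hh t d - hh t c) * ori a b d + (hh t d - hh t a) * ori b c d := by
    unfold ori hh; ring
  have gen : ∀ {k l m X Y Z : ℝ}, 0 < k → 0 < l → 0 < m → k * Y = l * X + m * Z →
      (0 < X → 0 < Z → 0 < Y) ∧ (X < 0 → Z < 0 → Y < 0) := by
    intro k l m X Y Z hk hl hm h
    constructor
    · intro hX hZ
      have : 0 < k * Y := by rw [h]; positivity
      exact (mul_pos_iff_of_pos_left hk).1 this
    · intro hX hZ
      have h5 := mul_pos_of_neg_of_neg hX (show -l < 0 by linarith)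
      have h6 := mul_pos_of_neg_of_neg hZ (show -m < 0 by linarith)
      have : 0 < k * (-Y) := by linarith
      have := (mul_pos_iff_of_pos_left hk).1 this
      linarith
  have g1 := gen (by linarith) (by linarith) (by linarith) e1
  have g2 := gen (by linarith) (by linarith) (by linarith) e2
  have g3 := gen (by linarith) (by linarith) (by linarith) e3
  have g4 := gen (by linarith) (by linarith) (by linarith) e4
  rcases lt_or_gt_of_ne h1 with k1 | k1 <;> rcases lt_or_gt_of_ne h2 with k2 | k2 <;>
  rcases lt_or_gt_of_ne h3 with k3 | k3 <;> rcases lt_or_gt_of_ne h4 with k4 | k4 <;>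
  first
  | (simp [quadOK, k1, k2, k3, k4, not_lt_of_gt]; done)
  | (exfalso; obtain ⟨a1, b1⟩ := g1; obtain ⟨a2, b2⟩ := g2; obtain ⟨a3, b3⟩ := g3
     obtain ⟨a4, b4⟩ := g4
     simp only [k1, k2, k3, k4, true_implies] at a1 b1 a2 b2 a3 b3 a4 b4
     linarith)

lemma trips_tidx : ∀ k < 6, ∀ j < k, ∀ i < j,
    trips.getD (tidx i j k) (0, 0, 0) = (i, j, k) ∧ tidx i j k < 20 := by decide +kernel

lemma trips_lt : ∀ n < 20, ∀ x, x = trips.getD n (0, 0, 0) →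
    x.1 < x.2.1 ∧ x.2.1 < x.2.2 ∧ x.2.2 < 6 ∧ tidx x.1 x.2.1 x.2.2 = n := by
  intro n hn x hx
  subst hx
  revert n
  decide +kernel

lemma tidx_le : ∀ l < 6, ∀ k < l, ∀ j < k, ∀ i < j, tidx i j k < tidx j k l ∧
    tidx i j l < tidx j k l ∧ tidx i k l < tidx j k l := by decide +kernel

lemma pack_six {S : Finset Pt} (hS : S.card = 6) (hgp : GenPos S) : Pack S := by
  obtain ⟨t, ht⟩ := exists_shear S
  have hinjOn : Set.InjOn (hh t) S := fun p hp q hq h => ht p hp q hq h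
  have hcard : (S.image (hh t)).card = 6 := by rw [Finset.card_image_of_injOn hinjOn, hS]
  let o := (S.image (hh t)).orderEmbOfFin hcard
  have ho : ∀ i, ∃ q ∈ S, hh t q = o i := fun i =>
    Finset.mem_image.1 (Finset.orderEmbOfFin_mem _ hcard i)
  choose q hqS hq using ho
  let p : ℕ → Pt := fun n => if hn : n < 6 then q ⟨n, hn⟩ else q 0
  have hpS : ∀ i, p i ∈ S := by
    intro i; dsimp only [p]; split_ifs <;> exact hqS _
  have hmono : ∀ i j, i < j → j < 6 → hh t (p i) < hh t (p j) := by
    intro i j hij hj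
    have hi : i < 6 := by omega
    simp only [p, hi, hj, dif_pos, hq]
    exact o.strictMono hij
  have hinj : ∀ i < 6, ∀ j < 6, p i = p j → i = j := by
    intro i hi j hj h
    rcases lt_trichotomy i j with h' | h' | h'
    · have := hmono i j h' hj; rw [h] at this; exact absurd this (lt_irrefl _)
    · exact h'
    · have := hmono j i h' hi; rw [h] at this; exact absurd this (lt_irrefl _)
  have himg : (Finset.range 6).image p = S := by
    apply Finset.eq_of_subset_of_card_le
    · intro x hx
      obtain ⟨i, _, rfl⟩ := Finset.mem_image.1 hx
      exact hpS i
    · rw [hS, Finset.card_image_of_injOn]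
      · simp
      · intro i hi j hj h
        exact hinj i (by simpa using hi) j (by simpa using hj) h
  have hori : ∀ i < 6, ∀ j < 6, ∀ k < 6, i ≠ j → i ≠ k → j ≠ k →
      ori (p i) (p j) (p k) ≠ 0 := by
    intro i hi j hj k hk hij hik hjk
    exact ori_ne_zero hgp (hpS i) (hpS j) (hpS k) (fun h => hij (hinj i hi j hj h))
      (fun h => hik (hinj i hi k hk h)) (fun h => hjk (hinj j hj k hk h))
  let τ : ℕ → ℕ → ℕ → Bool := fun i j k => decide (0 < ori (p i) (p j) (p k))
  let σ : ℕ → Bool := fun n => τ (trips.getD n (0, 0, 0)).1 (trips.getD n (0, 0, 0)).2.1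
    (trips.getD n (0, 0, 0)).2.2
  have hστ : ∀ i j k, i < j → j < k → k < 6 → σ (tidx i j k) = τ i j k := by
    intro i j k hij hjk hk
    simp only [σ, (trips_tidx k hk j hjk i hij).1]
  obtain ⟨acc, hacc, hok⟩ := search_sound σ (by
    intro n acc hn hb
    obtain ⟨h1, h2, h3, h4⟩ := trips_lt n hn _ rfl
    unfold goodAt
    revert h1 h2 h3 h4
    generalize trips.getD n (0, 0, 0) = x
    obtain ⟨j, k, l⟩ := x
    intro h1 h2 h3 h4
    dsimp only at h1 h2 h3 h4 ⊢
    rw [List.all_eq_true]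
    intro i hi
    rw [List.mem_range] at hi
    obtain ⟨g1, g2, g3⟩ := tidx_le l h3 k h2 j h1 i hi
    unfold bt
    rw [hb _ (by omega), hb _ (by omega), hb _ (by omega), hb _ (by omega),
      hστ _ _ _ hi h1 (by omega), hστ _ _ _ hi (by omega) h3, hστ _ _ _ (by omega) h2 h3,
      hστ _ _ _ h1 h2 h3]
    exact signotope_aux t (hmono i j hi (by omega)) (hmono j k h1 (by omega)) (hmono k l h2 h3)
      (hori _ (by omega) _ (by omega) _ (by omega) (by omega) (by omega) (by omega))
      (hori _ (by omega) _ (by omega) _ (by omega) (by omega) (by omega) (by omega))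
      (hori _ (by omega) _ (by omega) _ (by omega) (by omega) (by omega) (by omega))
      (hori _ (by omega) _ (by omega) _ (by omega) (by omega) (by omega) (by omega)))
    20 0 0 (by norm_num) (by norm_num) (by intro i hi; omega) search_true
  have hbt : ∀ i j k, i < j → j < k → k < 6 → bt acc i j k = τ i j k := by
    intro i j k hij hjk hk
    unfold bt
    rw [hacc _ (trips_tidx k hk j hjk i hij).2, hστ i j k hij hjk hk]
  have flip : ∀ {u v : ℝ}, u ≠ 0 → u = -v → (!decide (0 < u)) = decide (0 < v) := by
    intro u v hu h
    rcases lt_or_gt_of_ne hu with h' | h'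
    · have : 0 < v := by linarith
      simp [this, not_lt_of_gt h']
    · have : ¬ 0 < v := by linarith
      simp [this, h']
  have hsg : ∀ i < 6, ∀ j < 6, ∀ k < 6, i ≠ j → i ≠ k → j ≠ k → sg acc i j k = τ i j k := by
    intro i hi j hj k hk hij hik hjk
    unfold sg
    split_ifs with h1 h2 h3 h2 h3
    · exact hbt _ _ _ h1 h2 hk
    · rw [hbt i k j h3 (by omega) hj]
      exact flip (hori _ hi _ hk _ hj hik hij hjk.symm) (ori_swap _ _ _)
    · rw [hbt k i j (by omega) h1 hj]
      simp only [τ]; rw [ori_rot]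
    · rw [hbt j i k (by omega) h2 hk]
      exact flip (hori _ hj _ hi _ hk hij.symm hjk hik) (ori_swap' _ _ _)
    · rw [hbt j k i h3 (by omega) hi]
      simp only [τ]; rw [← ori_rot]
    · rw [hbt k j i (by omega) (by omega) hi]
      refine flip (hori _ hk _ hj _ hi hjk.symm hik.symm hij.symm) ?_
      unfold ori; ring
  have side : ∀ {a b c d : Pt}, ori a b c ≠ 0 → ori a b d ≠ 0 →
      decide (0 < ori a b c) = decide (0 < ori a b d) →
      openSegment ℝ a b ∩ openSegment ℝ c d = ∅ := by
    intro a b c d h1 h2 h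
    rw [decide_eq_decide] at h
    rcases lt_or_gt_of_ne h1 with h' | h'
    · have : ori a b d < 0 := by
        rcases lt_or_gt_of_ne h2 with h'' | h''
        · exact h''
        · exact absurd (h.2 h'') (not_lt_of_gt h')
      exact no_cross_of_neg h'.le this.le (Or.inl h')
    · exact no_cross_of_pos h'.le (h.1 h').le (Or.inl h')
  have share : ∀ i < 6, ∀ j < 6, ∀ k < 6, i ≠ j → i ≠ k → j ≠ k →
      openSegment ℝ (p i) (p j) ∩ openSegment ℝ (p i) (p k) = ∅ := by
    intro i hi j hj k hk hij hik hjk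
    have h0 := hori i hi j hj k hk hij hik hjk
    have h1 := ori_self1 (p i) (p j)
    rcases lt_or_gt_of_ne h0 with h | h
    · exact no_cross_of_neg h1.le h.le (Or.inr h)
    · exact no_cross_of_pos h1.ge h.le (Or.inr h)
  have ncs : ∀ e f : ℕ × ℕ, e.1 < 6 → e.2 < 6 → e.1 ≠ e.2 → f.1 < 6 → f.2 < 6 → f.1 ≠ f.2 →
      nc acc e f = true → s(p e.1, p e.2) ≠ s(p f.1, p f.2) →
      openSegment ℝ (p e.1) (p e.2) ∩ openSegment ℝ (p f.1) (p f.2) = ∅ := by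
    rintro ⟨i, j⟩ ⟨k, l⟩ hi hj hij hk hl hkl h hne
    dsimp only at hi hj hij hk hl hkl hne ⊢
    by_cases c1 : i = k
    · subst c1
      exact share i hi j hj l hl hij hkl (by rintro rfl; exact hne rfl)
    by_cases c2 : i = l
    · subst c2
      rw [openSegment_symm ℝ (p k)]
      exact share i hi j hj k hk hij hkl.symm (by rintro rfl; exact hne Sym2.eq_swap)
    by_cases c3 : j = k
    · subst c3
      rw [openSegment_symm ℝ (p i)]
      exact share j hj i hi l hl hij.symm hkl c2
    by_cases c4 : j = l
    · subst c4
      rw [openSegment_symm ℝ (p i), openSegment_symm ℝ (p k)]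
      exact share j hj i hi k hk hij.symm hkl.symm c1
    simp only [nc, Bool.or_eq_true, beq_iff_eq, c1, c2, c3, c4, false_or] at h
    rcases h with h | h
    · rw [hsg i hi j hj k hk hij c1 c3, hsg i hi j hj l hl hij c2 c4] at h
      exact side (hori i hi j hj k hk hij c1 c3) (hori i hi j hj l hl hij c2 c4) h
    · rw [hsg k hk l hl i hi hkl (Ne.symm c1) (Ne.symm c2),
        hsg k hk l hl j hj hkl (Ne.symm c3) (Ne.symm c4)] at h
      rw [Set.inter_comm]
      exact side (hori k hk l hl i hi hkl (Ne.symm c1) (Ne.symm c2))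
        (hori k hk l hl j hj hkl (Ne.symm c3) (Ne.symm c4)) h
  have tree : ∀ u : List (ℕ × ℕ), validT [0] u = true → planeT acc u = true →
      ∃ E, BT S E ∧ PlaneE E ∧ (∀ e, e ∈ E ↔ ∃ a ∈ u, e = s(p a.1, p a.2)) := by
    intro u hv hp
    have hv0 : ∀ i ∈ [0], i < 6 := by simp
    obtain ⟨E, hE, hmem⟩ := validT_BT p hinj u [0] ∅ hv0 hv (by simpa using BT.single (p 0))
    rw [himg] at hE
    have hmem' : ∀ e, e ∈ E ↔ ∃ a ∈ u, e = s(p a.1, p a.2) := by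
      intro e; rw [hmem e]; simp
    refine ⟨E, hE, ?_, hmem'⟩
    have hlt := validT_lt u [0] hv0 hv
    have hseg : ∀ {a b c d : Pt}, s(a, b) = s(c, d) →
        openSegment ℝ a b = openSegment ℝ c d := by
      intro a b c d h
      rcases Sym2.eq_iff.1 h with ⟨rfl, rfl⟩ | ⟨rfl, rfl⟩
      · rfl
      · exact openSegment_symm ℝ _ _
    intro a b c d hab hcd hne
    obtain ⟨e, he, hee⟩ := (hmem' _).1 hab
    obtain ⟨f, hf, hff⟩ := (hmem' _).1 hcd
    rw [hseg hee, hseg hff]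
    obtain ⟨e1, e2, e3⟩ := hlt e he
    obtain ⟨f1, f2, f3⟩ := hlt f hf
    refine ncs e f e1 e2 e3 f1 f2 f3 ?_ (by rw [← hee, ← hff]; exact hne)
    simp only [planeT, List.all_eq_true] at hp
    exact hp e he f hf
  have disj : ∀ (u v : List (ℕ × ℕ)) (E F : Finset (Sym2 Pt)), validT [0] u = true →
      validT [0] v = true → disjT u v = true →
      (∀ e, e ∈ E ↔ ∃ a ∈ u, e = s(p a.1, p a.2)) →
      (∀ e, e ∈ F ↔ ∃ a ∈ v, e = s(p a.1, p a.2)) → Disjoint E F := by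
    intro u v E F hu hv hd hE hF
    rw [Finset.disjoint_left]
    intro z hz hz'
    obtain ⟨e, he, rfl⟩ := (hE _).1 hz
    obtain ⟨f, hf, hff⟩ := (hF _).1 hz'
    have hv0 : ∀ i ∈ [0], i < 6 := by simp
    obtain ⟨e1, e2, e3⟩ := validT_lt u [0] hv0 hu e he
    obtain ⟨f1, f2, f3⟩ := validT_lt v [0] hv0 hv f hf
    simp only [disjT, List.all_eq_true] at hd
    have h := hd e he f hf
    simp only [Bool.not_eq_true', Bool.or_eq_false_iff, Bool.and_eq_false_iff,
      beq_eq_false_iff_ne] at h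
    rcases Sym2.eq_iff.1 hff with ⟨h1, h2⟩ | ⟨h1, h2⟩
    · have := hinj _ e1 _ f1 h1
      have := hinj _ e2 _ f2 h2
      tauto
    · have := hinj _ e1 _ f2 h1
      have := hinj _ e2 _ f1 h2
      tauto
  obtain ⟨c, hc, hpl⟩ := List.any_eq_true.1 hok
  have hval := colorings_valid c hc
  simp only [validC, Bool.and_eq_true] at hval hpl
  obtain ⟨⟨⟨⟨⟨v0, v1⟩, v2⟩, d01⟩, d02⟩, d12⟩ := hval
  obtain ⟨p0, p1, p2⟩ := hpl
  obtain ⟨E0, b0, q0, m0⟩ := tree _ v0 p0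
  obtain ⟨E1, b1, q1, m1⟩ := tree _ v1 p1
  obtain ⟨E2, b2, q2, m2⟩ := tree _ v2 p2
  have D01 := disj _ _ _ _ v0 v1 d01 m0 m1
  have D02 := disj _ _ _ _ v0 v2 d02 m0 m2
  have D12 := disj _ _ _ _ v1 v2 d12 m1 m2
  refine ⟨![E0, E1, E2], ?_, ?_, ?_⟩
  · intro i; fin_cases i <;> assumption
  · intro i; fin_cases i <;> assumption
  · intro i j hij
    fin_cases i <;> fin_cases j <;>
      first
      | exact absurd rfl hij
      | exact D01
      | exact D02
      | exact D12
      | exact D01.symm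
      | exact D02.symm
      | exact D12.symm

lemma pack_all : ∀ n, 6 ≤ n → ∀ S : Finset Pt, S.card = n → GenPos S → Pack S := by
  intro n hn
  induction n, hn using Nat.le_induction with
  | base => intro S hS hgp; exact pack_six hS hgp
  | succ n hn ih =>
    intro S hS hgp
    obtain ⟨t, ht⟩ := exists_shear S
    have hne : S.Nonempty := Finset.card_pos.1 (by omega)
    obtain ⟨x, hx, hmin⟩ := S.exists_min_image (hh t) hne
    have hins : insert x (S.erase x) = S := Finset.insert_erase hx
    have hc : (S.erase x).card = n := by rw [Finset.card_erase_of_mem hx, hS]; rfl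
    rw [← hins]
    apply pack_step t (Finset.notMem_erase x S)
    · intro q hq
      obtain ⟨h1, h2⟩ := Finset.mem_erase.1 hq
      exact lt_of_le_of_ne (hmin q h2) (fun h => h1 (ht x hx q h2 h).symm)
    · rw [hins]; exact hgp
    · omega
    · apply ih _ hc
      intro a ha b hb c hc'
      exact hgp a (Finset.mem_of_mem_erase ha) b (Finset.mem_of_mem_erase hb) c
        (Finset.mem_of_mem_erase hc')

/-- Every set of n ≥ 6 points in general position admits at least 3 pairwise edge-disjoint plane spanning trees. -/
theorem three_spanning_trees (S : Finset Pt) (n : ℕ) (hS : S.card = n) (hgp : GenPos S)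
    (hn : 6 ≤ n) :
    ∃ T : Fin 3 → SimpleGraph {x // x ∈ S},
      (∀ i, IsPlaneSpanningTree (T i)) ∧
      (∀ i j, i ≠ j → Disjoint (T i).edgeSet (T j).edgeSet) :=
  (pack_all n hn S hS hgp).final
end
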